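/- Let M be a monotone Möbius structure on S¹ satisfying the Increment axiom. Then every line h ⊂ Harm is a geodesic for the zig-zag pseudometric δ: for any q, q' on a common line, δ(q,q') = |qq'|. -/

import Mathlib

open scoped Classical

section Mobius

variable {X : Type*}

/-- The pairs `(x,y)` and `(z,u)` separate each other on the circularly ordered set `X`:
`z` and `u` lie on different open arcs determined by `x` and `y`. -/
def PairSeparates [CircularOrder X] (x y z u : X) : Prop :=
  (sbtw x z y ∧ sbtw y u x) ∨ (sbtw x u y ∧ sbtw y z x)

/-- The pair `(d₁,d₂)` separates the pairs `(b₁,b₂)` and `(c₁,c₂)`: the latter two pairs lie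
on different open arcs determined by `(d₁,d₂)`. -/
def ArcSepPairs [CircularOrder X] (d₁ d₂ b₁ b₂ c₁ c₂ : X) : Prop :=
  (sbtw d₁ b₁ d₂ ∧ sbtw d₁ b₂ d₂ ∧ sbtw d₂ c₁ d₁ ∧ sbtw d₂ c₂ d₁) ∨
  (sbtw d₁ c₁ d₂ ∧ sbtw d₁ c₂ d₂ ∧ sbtw d₂ b₁ d₁ ∧ sbtw d₂ b₂ d₁)

/-- Two pairs `(b₁,b₂)` and `(c₁,c₂)` of points are in the strong causal relation:
either of them lies entirely in one open arc determined by the other. -/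
def StrongCausal [CircularOrder X] (b₁ b₂ c₁ c₂ : X) : Prop :=
  (sbtw b₁ c₁ b₂ ∧ sbtw b₁ c₂ b₂) ∨ (sbtw b₂ c₁ b₁ ∧ sbtw b₂ c₂ b₁) ∨
  (sbtw c₁ b₁ c₂ ∧ sbtw c₁ b₂ c₂) ∨ (sbtw c₂ b₁ c₁ ∧ sbtw c₂ b₂ c₁)

/-- The topology generated by open balls of the semi-metrics with infinitely remote points,
centered at finite points. `D ω x y` denotes `|xy|` in the semi-metric with infinitely remote
point `ω`. -/
def MTopology (D : X → X → X → ℝ) : TopologicalSpace X :=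
  TopologicalSpace.generateFrom
    {s | ∃ ω x r, x ≠ ω ∧ s = {y | y ≠ ω ∧ D ω x y < r}}

/-- A (ptolemaic) monotone Möbius structure on a circle `X`, presented by the family of its
semi-metrics with infinitely remote points: `D ω x y` is the distance `|xy|_ω` in the
semi-metric with infinitely remote point `ω` (defined for `x, y ≠ ω`).  The semi-metrics
are pairwise related by metric inversion (up to homothety), every one of them satisfies the
Ptolemy inequality, the monotonicity axiom (M) holds, the M-topology is the given topology
of `X`, and `X` is homeomorphic to the circle. -/
structure MonotoneMobius (X : Type*) [CircularOrder X] [t : TopologicalSpace X] where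
  D : X → X → X → ℝ
  symm : ∀ ω x y, D ω x y = D ω y x
  refl : ∀ ω x, D ω x x = 0
  pos : ∀ ω x y, x ≠ y → x ≠ ω → y ≠ ω → 0 < D ω x y
  inversion : ∀ ω ω', ω ≠ ω' → ∃ c : ℝ, 0 < c ∧ ∀ x y, x ≠ ω → y ≠ ω → x ≠ ω' → y ≠ ω' →
    D ω' x y = c * D ω x y / (D ω x ω' * D ω y ω')
  ptolemy : ∀ ω x y z u, x ≠ ω → y ≠ ω → z ≠ ω → u ≠ ω →
    D ω x y * D ω z u ≤ D ω x z * D ω y u + D ω x u * D ω y z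
  mono : ∀ ω x y z u, x ≠ ω → y ≠ ω → z ≠ ω → u ≠ ω → PairSeparates x y z u →
    D ω x z * D ω y u < D ω x y * D ω z u ∧ D ω x u * D ω y z < D ω x y * D ω z u
  mtop : MTopology D = t
  circle : Nonempty (X ≃ₜ AddCircle (1 : ℝ))

variable [CircularOrder X] [TopologicalSpace X]

/-- The 4-tuple `(x,y,z,u)` is harmonic (of the first type): `|xz||yu| = |xu||yz|` in any
semi-metric of the Möbius structure. -/
def MonotoneMobius.Harmonic (M : MonotoneMobius X) (x y z u : X) : Prop :=
  ∀ ω, ω ≠ x → ω ≠ y → ω ≠ z → ω ≠ u →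
    M.D ω x z * M.D ω y u = M.D ω x u * M.D ω y z

/-- The distance `|q q'| = |ln ((|xp'||yp|)/(|xp||yp'|))|` between two harmonic pairs
`q = ((x,y),(p,·))` and `q' = ((x,y),(p',·))` with common axis `(x,y)`; computed here in the
semi-metric with infinitely remote point `x`, where it equals `|ln (|yp|_x / |yp'|_x)|`. -/
noncomputable def MonotoneMobius.lineDist (M : MonotoneMobius X) (x y p p' : X) : ℝ :=
  |Real.log (M.D x y p / M.D x y p')|

end Mobius

section Harm

variable {X : Type*} [CircularOrder X] [TopologicalSpace X]

/-- A point of the space `Harm`: a harmonic pair `((x,y),(z,u))` of pairs of distinct points,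
with left axis `(x,y)` and right axis `(z,u)` (the entries of each axis being unordered). -/
structure HarmPt (M : MonotoneMobius X) where
  x : X
  y : X
  z : X
  u : X
  hxy : x ≠ y
  hxz : x ≠ z
  hxu : x ≠ u
  hyz : y ≠ z
  hyu : y ≠ u
  hzu : z ≠ u
  harm : M.Harmonic x y z u

variable {M : MonotoneMobius X}

/-- `q` and `q'` have the same left axis (as unordered pairs), i.e. lie on a common left line. -/
def leftAxisEq (q q' : HarmPt M) : Prop :=
  (q.x = q'.x ∧ q.y = q'.y) ∨ (q.x = q'.y ∧ q.y = q'.x)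

/-- `q` and `q'` have the same right axis (as unordered pairs), i.e. lie on a common right line. -/
def rightAxisEq (q q' : HarmPt M) : Prop :=
  (q.z = q'.z ∧ q.u = q'.u) ∨ (q.z = q'.u ∧ q.u = q'.z)

/-- The length of the left segment from `q` to `q'` (lying on a common left line). -/
noncomputable def stepDistL (q q' : HarmPt M) : ℝ := M.lineDist q.x q.y q.z q'.z

/-- The length of the right segment from `q` to `q'` (lying on a common right line). -/
noncomputable def stepDistR (q q' : HarmPt M) : ℝ := M.lineDist q.z q.u q.x q'.x

/-- `ZZ q q' b n L` : there is a zig-zag path from `q` to `q'` with `n` sides of total length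
`L`, alternating between left and right segments, whose first side is a left segment if
`b = true` and a right segment if `b = false`; sides are nondegenerate (they join distinct
points of `Harm`). -/
inductive ZZ : HarmPt M → HarmPt M → Bool → ℕ → ℝ → Prop
  | nil (q : HarmPt M) (b : Bool) : ZZ q q b 0 0
  | left {q q' qe : HarmPt M} {n : ℕ} {L : ℝ} (hne : ¬ rightAxisEq q q')
      (hax : leftAxisEq q q') (rest : ZZ q' qe false n L) :
      ZZ q qe true (n + 1) (stepDistL q q' + L)
  | right {q q' qe : HarmPt M} {n : ℕ} {L : ℝ} (hne : ¬ leftAxisEq q q')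
      (hax : rightAxisEq q q') (rest : ZZ q' qe true n L) :
      ZZ q qe false (n + 1) (stepDistR q q' + L)

/-- The zig-zag distance `δ(q,q')`: the infimum of the lengths of zig-zag paths from `q` to
`q'` (`⊤` if there is none). -/
noncomputable def zzDist (q q' : HarmPt M) : ENNReal :=
  sInf {e : ENNReal | ∃ (r : ℝ) (b : Bool) (n : ℕ), ZZ q q' b n r ∧ e = ENNReal.ofReal r}

end Harm

section Increment

variable {X : Type*} [CircularOrder X] [TopologicalSpace X]

/-- The seven points are in cyclic order `1234567` on the circle. -/
def Cyclic7 [CircularOrder X] (x1 x2 x3 x4 x5 x6 x7 : X) : Prop :=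
  sbtw x1 x2 x3 ∧ sbtw x2 x3 x4 ∧ sbtw x3 x4 x5 ∧ sbtw x4 x5 x6 ∧
  sbtw x5 x6 x7 ∧ sbtw x6 x7 x1 ∧ sbtw x7 x1 x2

/-- Increment Axiom (I): for any nondegenerate 7-tuple `q` in cyclic order `1234567` such
that `q_{247}` and `q_{157}` are harmonic, `cr₁(q_{345}) > cr₁(q_{123})` (in any semi-metric
of the structure finite on the tuple). -/
def MonotoneMobius.Increment (M : MonotoneMobius X) : Prop :=
  ∀ x1 x2 x3 x4 x5 x6 x7 : X, Cyclic7 x1 x2 x3 x4 x5 x6 x7 →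
    M.Harmonic x1 x3 x5 x6 → M.Harmonic x2 x3 x4 x6 →
    ∀ ω, ω ≠ x1 → ω ≠ x2 → ω ≠ x3 → ω ≠ x4 → ω ≠ x5 → ω ≠ x6 → ω ≠ x7 →
      M.D ω x4 x6 * M.D ω x5 x7 / (M.D ω x4 x7 * M.D ω x5 x6) <
      M.D ω x1 x6 * M.D ω x2 x7 / (M.D ω x1 x7 * M.D ω x2 x6)

end Increment

section CircularSeparation

variable {X : Type*} [CircularOrder X]

theorem sbtw_or_sbtw_of_ne {a b c : X} (hab : a ≠ b) (hac : a ≠ c) (hbc : b ≠ c) :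
    sbtw a b c ∨ sbtw a c b := by
  by_cases h : btw c b a
  · right
    have h' : ¬ btw b c a := fun h'' => by
      rcases btw_antisymm h (btw_cyclic_left (btw_cyclic_left h'')) with h | h | h
      · exact hbc h.symm
      · exact hab h.symm
      · exact hac h
    exact sbtw_iff_not_btw.2 h'
  · exact Or.inl (sbtw_iff_not_btw.2 h)

theorem sbtw_of_sbtw_sbtw {x a b c : X} (h : sbtw x a b) (h' : sbtw x b c) : sbtw a b c :=
  (h'.cyclic_right.trans_left h).cyclic_left

theorem sbtw_trans_base {x a b c : X} (h : sbtw x a b) (h' : sbtw x b c) : sbtw x a c :=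
  sbtw_trans_right h h'

theorem pairSeparates_total {x y z u : X} (hxy : x ≠ y) (hxz : x ≠ z) (hxu : x ≠ u)
    (hyz : y ≠ z) (hyu : y ≠ u) (hzu : z ≠ u) :
    PairSeparates x y z u ∨ PairSeparates x z y u ∨ PairSeparates x u y z := by
  have C : ∀ {a b c : X}, sbtw a b c → sbtw b c a := fun h => h.cyclic_left
  rcases sbtw_or_sbtw_of_ne hxy hxz hyz with h1 | h1 <;>
  rcases sbtw_or_sbtw_of_ne hxy hxu hyu with h2 | h2 <;>
  rcases sbtw_or_sbtw_of_ne hxz hxu hzu with h3 | h3 <;>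
  simp only [PairSeparates] <;> have := C h1 <;> have := C h2 <;> have := C h3 <;> tauto

/-- Two points `p`, `q` on the arc of `(x,y)` opposite to `o` are ordered on that arc. -/
theorem pairSeparates_dichotomy {x y o p q : X} (hp : PairSeparates x y o p)
    (hq : PairSeparates x y o q) (hpq : p ≠ q) :
    (PairSeparates x q p y ∧ PairSeparates x q p o ∧ PairSeparates p y q o) ∨
    (PairSeparates x p q y ∧ PairSeparates x p q o ∧ PairSeparates q y p o) := by
  have C : ∀ {a b c : X}, sbtw a b c → sbtw b c a := fun h => h.cyclic_left
  have key : ∀ {p q : X}, sbtw x o y → sbtw x y p → sbtw x p q →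
      PairSeparates x p q y ∧ PairSeparates x p q o ∧ PairSeparates q y p o := by
    intro p q h1 h2 h3
    exact ⟨Or.inr ⟨h2, C h3⟩, Or.inr ⟨sbtw_trans_base h1 h2, C h3⟩,
      Or.inr ⟨C (C (sbtw_of_sbtw_sbtw h1 (sbtw_trans_base h2 h3))), sbtw_of_sbtw_sbtw h2 h3⟩⟩
  have key' : ∀ {p q : X}, sbtw x y o → sbtw x q y → sbtw x p q →
      PairSeparates x q p y ∧ PairSeparates x q p o ∧ PairSeparates p y q o := by
    intro p q h1 h2 h3
    exact ⟨Or.inl ⟨h3, C h2⟩, Or.inl ⟨h3, C (sbtw_trans_base h2 h1)⟩,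
      Or.inl ⟨sbtw_of_sbtw_sbtw h3 h2, C (sbtw_of_sbtw_sbtw (sbtw_trans_base h3 h2) h1)⟩⟩
  rcases hp with ⟨h1, h2⟩ | ⟨h1, h2⟩ <;> rcases hq with ⟨h3, h4⟩ | ⟨h3, h4⟩
  · have hxp : x ≠ p := fun h => sbtw_irrefl_right (h ▸ h2)
    have hxq : x ≠ q := fun h => sbtw_irrefl_right (h ▸ h4)
    rcases sbtw_or_sbtw_of_ne hxp hxq hpq with h | h
    · exact Or.inr (key h1 (C (C h2)) h)
    · exact Or.inl (key h1 (C (C h4)) h)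
  · exact absurd h1 (fun h => sbtw_asymm h h4)
  · exact absurd h3 (fun h => sbtw_asymm h h2)
  · have hxp : x ≠ p := fun h => sbtw_irrefl_left (h ▸ h1)
    have hxq : x ≠ q := fun h => sbtw_irrefl_left (h ▸ h3)
    rcases sbtw_or_sbtw_of_ne hxp hxq hpq with h | h
    · exact Or.inl (key' (C (C h2)) h3 h)
    · exact Or.inr (key' (C (C h2)) h1 h)

theorem PairSeparates.separates_or {x y z u w : X} (h : PairSeparates x y z u)
    (hxy : x ≠ y) (hx : w ≠ x) (hy : w ≠ y) : PairSeparates x y z w ∨ PairSeparates x y u w := by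
  have C : ∀ {a b c : X}, sbtw a b c → sbtw b c a := fun h => h.cyclic_left
  rcases sbtw_or_sbtw_of_ne hxy hx.symm hy.symm with h1 | h1 <;> have := C h1 <;>
    simp only [PairSeparates] at * <;> tauto

theorem PairSeparates.symm_right {x y z u : X} (h : PairSeparates x y z u) :
    PairSeparates x y u z := Or.symm h

theorem PairSeparates.ne {x y z u : X} (h : PairSeparates x y z u) :
    x ≠ y ∧ x ≠ z ∧ x ≠ u ∧ y ≠ z ∧ y ≠ u ∧ z ≠ u := by
  rcases h with ⟨h1, h2⟩ | ⟨h1, h2⟩ <;> refine ⟨?_, ?_, ?_, ?_, ?_, ?_⟩ <;> rintro rfl <;>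
    first
    | exact sbtw_irrefl_left_right h1
    | exact sbtw_irrefl_left h1
    | exact sbtw_irrefl_right h1
    | exact sbtw_irrefl_left h2
    | exact sbtw_irrefl_right h2
    | exact sbtw_asymm h1 h2

end CircularSeparation

section Conformal

variable {X : Type*} [CircularOrder X] [TopologicalSpace X] (M : MonotoneMobius X)

theorem MonotoneMobius.infinite (M : MonotoneMobius X) : Infinite X := by
  obtain ⟨e⟩ := M.circle
  have : Infinite (AddCircle (1 : ℝ)) :=
    (AddCircle.equivIco (1 : ℝ) 0).infinite_iff.2 (Set.Ico_infinite (by norm_num)).to_subtype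
  exact e.toEquiv.infinite_iff.2 this

theorem MonotoneMobius.exists_forall_ne (M : MonotoneMobius X) (S : Finset X) :
    ∃ v : X, ∀ s ∈ S, v ≠ s := by
  have := M.infinite
  obtain ⟨v, hv⟩ := Infinite.exists_notMem_finset S
  exact ⟨v, fun s hs h => hv (h ▸ hs)⟩

theorem MonotoneMobius.triangle {v x y z : X} (hx : x ≠ v) (hy : y ≠ v) (hz : z ≠ v) :
    M.D v x y ≤ M.D v x z + M.D v z y := by
  obtain ⟨w, hw⟩ := M.exists_forall_ne {v, x, y, z}
  simp only [Finset.mem_insert, Finset.mem_singleton, forall_eq_or_imp, forall_eq] at hw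
  obtain ⟨wv, wx, wy, wz⟩ := hw
  obtain ⟨c, hc, hD⟩ := M.inversion w v wv
  have px := M.pos w x v hx wx.symm wv.symm
  have py := M.pos w y v hy wy.symm wv.symm
  have pz := M.pos w z v hz wz.symm wv.symm
  rw [hD x y wx.symm wy.symm hx hy, hD x z wx.symm wz.symm hx hz, hD z y wz.symm wy.symm hz hy]
  have h := M.ptolemy w x y z v wx.symm wy.symm wz.symm wv.symm
  rw [M.symm w y z] at h
  have e : c * M.D w x z / (M.D w x v * M.D w z v) + c * M.D w z y / (M.D w z v * M.D w y v) -
      c * M.D w x y / (M.D w x v * M.D w y v) =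
      c * (M.D w x z * M.D w y v + M.D w x v * M.D w z y - M.D w x y * M.D w z v) /
        (M.D w x v * M.D w y v * M.D w z v) := by
    field_simp
  have : 0 ≤ c * (M.D w x z * M.D w y v + M.D w x v * M.D w z y - M.D w x y * M.D w z v) /
        (M.D w x v * M.D w y v * M.D w z v) := by
    apply div_nonneg (mul_nonneg hc.le (by linarith)) (by positivity)
  linarith

/-- The logarithm of the distance in the semi-metric with infinitely remote point `v`. -/
noncomputable def MonotoneMobius.logD (v p q : X) : ℝ := Real.log (M.D v p q)

theorem MonotoneMobius.logD_symm (v p q : X) : M.logD v p q = M.logD v q p := by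
  rw [logD, logD, M.symm]

theorem MonotoneMobius.logD_lt {v x y z u : X} (h : PairSeparates x y z u) (hx : x ≠ v)
    (hy : y ≠ v) (hz : z ≠ v) (hu : u ≠ v) :
    M.logD v x z + M.logD v y u < M.logD v x y + M.logD v z u ∧
    M.logD v x u + M.logD v y z < M.logD v x y + M.logD v z u := by
  obtain ⟨xy, xz, xu, yz, yu, zu⟩ := h.ne
  have h1 := M.pos v x y xy hx hy
  have h2 := M.pos v x z xz hx hz
  have h3 := M.pos v x u xu hx hu
  have h4 := M.pos v y z yz hy hz
  have h5 := M.pos v y u yu hy hu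
  have h6 := M.pos v z u zu hz hu
  simp only [logD]
  rw [← Real.log_mul h1.ne' h6.ne', ← Real.log_mul h2.ne' h5.ne', ← Real.log_mul h3.ne' h4.ne']
  have := M.mono v x y z u hx hy hz hu h
  exact ⟨Real.log_lt_log (by positivity) this.1, Real.log_lt_log (by positivity) this.2⟩

theorem MonotoneMobius.lineDist_eq {v x y p q : X} (hxy : x ≠ y) (hxp : x ≠ p) (hxq : x ≠ q)
    (hyp : y ≠ p) (hyq : y ≠ q) (vx : x ≠ v) (vy : y ≠ v) (vp : p ≠ v) (vq : q ≠ v) :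
    M.lineDist x y p q =
      |M.logD v y p + M.logD v x q - M.logD v x p - M.logD v y q| := by
  obtain ⟨c, hc, hD⟩ := M.inversion v x vx.symm
  have h1 := M.pos v y x hxy.symm vy vx
  have h2 := M.pos v p x hxp.symm vp vx
  have h3 := M.pos v q x hxq.symm vq vx
  have h4 := M.pos v y p hyp vy vp
  have h5 := M.pos v y q hyq vy vq
  rw [lineDist, hD y p vy vp hxy.symm hxp.symm, hD y q vy vq hxy.symm hxq.symm]
  have e : c * M.D v y p / (M.D v y x * M.D v p x) / (c * M.D v y q / (M.D v y x * M.D v q x)) =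
      (M.D v y p * M.D v q x) / (M.D v p x * M.D v y q) := by
    field_simp
  rw [e, Real.log_div (by positivity) (by positivity), Real.log_mul h4.ne' h3.ne',
    Real.log_mul h2.ne' h5.ne']
  simp only [logD, M.symm v x]
  congr 1; ring

theorem MonotoneMobius.Harmonic.logD_eq {M : MonotoneMobius X} {v x y z u : X}
    (h : M.Harmonic x y z u) (hxz : x ≠ z) (hxu : x ≠ u) (hyz : y ≠ z) (hyu : y ≠ u)
    (vx : x ≠ v) (vy : y ≠ v) (vz : z ≠ v) (vu : u ≠ v) :
    M.logD v x z + M.logD v y u = M.logD v x u + M.logD v y z := by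
  have h2 := M.pos v x z hxz vx vz
  have h3 := M.pos v x u hxu vx vu
  have h4 := M.pos v y z hyz vy vz
  have h5 := M.pos v y u hyu vy vu
  simp only [logD]
  rw [← Real.log_mul h2.ne' h5.ne', ← Real.log_mul h3.ne' h4.ne',
    h v vx.symm vy.symm vz.symm vu.symm]

theorem MonotoneMobius.harmonic_of_logD_eq {v x y z u : X} (hxz : x ≠ z) (hxu : x ≠ u)
    (hyz : y ≠ z) (hyu : y ≠ u) (vx : x ≠ v) (vy : y ≠ v) (vz : z ≠ v) (vu : u ≠ v)
    (h : M.logD v x z + M.logD v y u = M.logD v x u + M.logD v y z) : M.Harmonic x y z u := by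
  have h2 := M.pos v x z hxz vx vz
  have h3 := M.pos v x u hxu vx vu
  have h4 := M.pos v y z hyz vy vz
  have h5 := M.pos v y u hyu vy vu
  simp only [logD] at h
  rw [← Real.log_mul h2.ne' h5.ne', ← Real.log_mul h3.ne' h4.ne'] at h
  have h := Real.log_injOn_pos (Set.mem_Ioi.2 (by positivity)) (Set.mem_Ioi.2 (by positivity)) h
  intro w wx wy wz wu
  by_cases hvw : v = w
  · rwa [← hvw]
  obtain ⟨c, hc, hD⟩ := M.inversion v w hvw
  have px := M.pos v x w wx.symm vx (Ne.symm hvw)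
  have py := M.pos v y w wy.symm vy (Ne.symm hvw)
  have pz := M.pos v z w wz.symm vz (Ne.symm hvw)
  have pu := M.pos v u w wu.symm vu (Ne.symm hvw)
  rw [hD x z vx vz wx.symm wz.symm, hD y u vy vu wy.symm wu.symm, hD x u vx vu wx.symm wu.symm,
    hD y z vy vz wy.symm wz.symm]
  field_simp
  linear_combination h

theorem MonotoneMobius.Harmonic.swap {M : MonotoneMobius X} {x y z u : X}
    (h : M.Harmonic x y z u) : M.Harmonic z u x y := by
  intro w wz wu wx wy
  rw [M.symm w z x, M.symm w u y, M.symm w z y, M.symm w u x, h w wx wy wz wu, mul_comm]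

theorem MonotoneMobius.Harmonic.pairSeparates {M : MonotoneMobius X} {x y z u : X}
    (h : M.Harmonic x y z u) (hxy : x ≠ y) (hxz : x ≠ z) (hxu : x ≠ u) (hyz : y ≠ z)
    (hyu : y ≠ u) (hzu : z ≠ u) : PairSeparates x y z u := by
  obtain ⟨v, hv⟩ := M.exists_forall_ne {x, y, z, u}
  simp only [Finset.mem_insert, Finset.mem_singleton, forall_eq_or_imp, forall_eq] at hv
  obtain ⟨vx, vy, vz, vu⟩ := hv
  have e := h v vx vy vz vu
  rcases pairSeparates_total hxy hxz hxu hyz hyu hzu with h | h | h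
  · exact h
  · have := (M.mono v x z y u vx.symm vz.symm vy.symm vu.symm h).2
    rw [M.symm v z y] at this
    linarith
  · have := (M.mono v x u y z vx.symm vu.symm vy.symm vz.symm h).2
    rw [M.symm v u y] at this
    linarith

end Conformal

section Potential

variable {X : Type*} [CircularOrder X] [TopologicalSpace X] (M : MonotoneMobius X)

/-- The inverse of the distance in the semi-metric with infinitely remote point `w`, computed up
to a factor in the semi-metric with infinitely remote point `v`; it vanishes at `w`. -/
noncomputable def MonotoneMobius.invDist (v w p q : X) : ℝ := M.D v p w * M.D v q w / M.D v p q

/-- A `1`-Lipschitz function on `Harm`: minus the logarithm of the shortest side of the harmonic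
quadruple in the semi-metric with infinitely remote point `w`, up to a constant depending on
the finite point of view `v`. -/
noncomputable def MonotoneMobius.potential (v w x y z u : X) : ℝ :=
  Real.log (max (max (M.invDist v w x z) (M.invDist v w x u))
    (max (M.invDist v w y z) (M.invDist v w y u)))

theorem MonotoneMobius.potential_swap_left (v w x y z u : X) :
    M.potential v w y x z u = M.potential v w x y z u := by
  rw [potential, potential, max_comm]

theorem MonotoneMobius.potential_swap_right (v w x y z u : X) :
    M.potential v w x y u z = M.potential v w x y z u := by
  rw [potential, potential, max_comm (M.invDist v w x u), max_comm (M.invDist v w y u)]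

theorem MonotoneMobius.invDist_symm (v w p q : X) : M.invDist v w p q = M.invDist v w q p := by
  rw [invDist, invDist, M.symm v p q, mul_comm]

theorem MonotoneMobius.potential_swap (v w x y z u : X) :
    M.potential v w z u x y = M.potential v w x y z u := by
  rw [potential, potential, M.invDist_symm v w z x, M.invDist_symm v w z y,
    M.invDist_symm v w u x, M.invDist_symm v w u y, max_max_max_comm]

theorem MonotoneMobius.invDist_pos {v w p q : X} (hpq : p ≠ q) (hp : p ≠ w) (hq : q ≠ w)
    (vp : p ≠ v) (vq : q ≠ v) (vw : w ≠ v) : 0 < M.invDist v w p q := by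
  have := M.pos v p q hpq vp vq
  have := M.pos v p w hp vp vw
  have := M.pos v q w hq vq vw
  rw [invDist]; positivity

theorem MonotoneMobius.log_invDist {v w p q : X} (hpq : p ≠ q) (hp : p ≠ w) (hq : q ≠ w)
    (vp : p ≠ v) (vq : q ≠ v) (vw : w ≠ v) :
    Real.log (M.invDist v w p q) = M.logD v p w + M.logD v q w - M.logD v p q := by
  have h1 := M.pos v p q hpq vp vq
  have h2 := M.pos v p w hp vp vw
  have h3 := M.pos v q w hq vq vw
  rw [invDist, Real.log_div (by positivity) h1.ne', Real.log_mul h2.ne' h3.ne']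
  rfl

theorem log_max_of_pos {a b : ℝ} (ha : 0 < a) (hb : 0 < b) :
    Real.log (max a b) = max (Real.log a) (Real.log b) := by
  rcases le_total a b with h | h
  · rw [max_eq_right h, max_eq_right (Real.log_le_log ha h)]
  · rw [max_eq_left h, max_eq_left (Real.log_le_log hb h)]

variable {M}

theorem MonotoneMobius.Harmonic.potential_of_mem {v x y z u : X} (h : M.Harmonic x y z u)
    (hxy : x ≠ y) (hxz : x ≠ z) (hyz : y ≠ z) (hyu : y ≠ u)
    (vx : x ≠ v) (vy : y ≠ v) (vz : z ≠ v) (vu : u ≠ v) :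
    M.potential v x x y z u = M.logD v x y + M.logD v x z - M.logD v y z := by
  have e : M.invDist v x y u = M.invDist v x y z := by
    have e := h v vx.symm vy.symm vz.symm vu.symm
    have h1 := M.pos v y z hyz vy vz
    have h2 := M.pos v y u hyu vy vu
    rw [invDist, invDist, div_eq_div_iff h2.ne' h1.ne', M.symm v u x, M.symm v z x]
    linear_combination -(M.D v y x) * e
  have h0 : ∀ p, M.invDist v x x p = 0 := fun p => by rw [invDist, M.refl, zero_mul, zero_div]
  have hp := M.invDist_pos hyz hxy.symm hxz.symm vy vz vx
  rw [potential, e, h0, h0, max_self, max_self, max_eq_right hp.le,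
    M.log_invDist hyz hxy.symm hxz.symm vy vz vx, M.logD_symm v y x, M.logD_symm v z x]

theorem MonotoneMobius.Harmonic.potential_of_separates {v w x y z u : X} (h : M.Harmonic x y z u)
    (hs : PairSeparates x y z u) (hw : PairSeparates x y z w)
    (vx : x ≠ v) (vy : y ≠ v) (vz : z ≠ v) (vu : u ≠ v) (vw : w ≠ v) :
    M.potential v w x y z u = max (M.logD v x w + M.logD v z w - M.logD v x z)
      (M.logD v y w + M.logD v z w - M.logD v y z) := by
  obtain ⟨xy, xz, xu, yz, yu, zu⟩ := hs.ne
  obtain ⟨-, -, xw, -, yw, zw⟩ := hw.ne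
  have e := h.logD_eq xz xu yz yu vx vy vz vu
  have pxz := M.invDist_pos xz xw zw vx vz vw
  have pyz := M.invDist_pos yz yw zw vy vz vw
  have key : M.invDist v w x u ≤ max (M.invDist v w x z) (M.invDist v w y z) ∧
      M.invDist v w y u ≤ max (M.invDist v w x z) (M.invDist v w y z) := by
    by_cases uw : u = w
    · have h0 : ∀ p, M.invDist v w p u = 0 := fun p => by
        rw [uw, invDist, M.refl, mul_zero, zero_div]
      rw [h0, h0]
      exact ⟨le_max_of_le_left pxz.le, le_max_of_le_left pxz.le⟩
    · have pxu := M.invDist_pos xu xw uw vx vu vw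
      have pyu := M.invDist_pos yu yw uw vy vu vw
      have lxz := M.log_invDist xz xw zw vx vz vw
      have lyz := M.log_invDist yz yw zw vy vz vw
      have lxu := M.log_invDist xu xw uw vx vu vw
      have lyu := M.log_invDist yu yw uw vy vu vw
      have s := M.logD_symm v
      have s1 := s w y
      have s2 := s w z
      have s3 := s u y
      have s4 := s u z
      rcases pairSeparates_dichotomy hs hw uw with ⟨h1, h2, h3⟩ | ⟨h1, h2, h3⟩
      · have i1 := M.logD_lt h3 vu vy vw vz
        have i2 := M.logD_lt h1 vx vw vu vy
        have a1 : M.invDist v w x u ≤ M.invDist v w x z := by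
          rw [← Real.log_le_log_iff pxu pxz]; linarith
        have a2 : M.invDist v w y u ≤ M.invDist v w x u := by
          rw [← Real.log_le_log_iff pyu pxu]; linarith
        exact ⟨le_max_of_le_left a1, le_max_of_le_left (a2.trans a1)⟩
      · have i1 := M.logD_lt h2 vx vu vw vz
        have i2 := M.logD_lt h1 vx vu vw vy
        have a1 : M.invDist v w y u ≤ M.invDist v w y z := by
          rw [← Real.log_le_log_iff pyu pyz]; linarith
        have a2 : M.invDist v w x u ≤ M.invDist v w y u := by
          rw [← Real.log_le_log_iff pxu pyu]; linarith
        exact ⟨le_max_of_le_right (a2.trans a1), le_max_of_le_right a1⟩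
  have : max (max (M.invDist v w x z) (M.invDist v w x u))
      (max (M.invDist v w y z) (M.invDist v w y u)) =
      max (M.invDist v w x z) (M.invDist v w y z) := by
    apply le_antisymm
    · exact max_le (max_le (le_max_left _ _) key.1) (max_le (le_max_right _ _) key.2)
    · exact max_le_max (le_max_left _ _) (le_max_left _ _)
  rw [potential, this, log_max_of_pos pxz pyz, M.log_invDist xz xw zw vx vz vw,
    M.log_invDist yz yw zw vy vz vw]

theorem MonotoneMobius.abs_max_sub_max_le_of_separates {v w x y z z' : X}
    (hz : PairSeparates x y z w) (hz' : PairSeparates x y z' w)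
    (vx : x ≠ v) (vy : y ≠ v) (vz : z ≠ v) (vz' : z' ≠ v) (vw : w ≠ v) :
    |max (M.logD v x w + M.logD v z w - M.logD v x z)
        (M.logD v y w + M.logD v z w - M.logD v y z) -
      max (M.logD v x w + M.logD v z' w - M.logD v x z')
        (M.logD v y w + M.logD v z' w - M.logD v y z')| ≤
    |M.logD v y z + M.logD v x z' - M.logD v x z - M.logD v y z'| := by
  by_cases hzz : z = z'
  · subst hzz
    rw [sub_self, abs_zero]; exact abs_nonneg _
  have s := M.logD_symm v
  refine (abs_max_sub_max_le_max _ _ _ _).trans ?_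
  rcases pairSeparates_dichotomy hz.symm_right hz'.symm_right hzz with ⟨-, h2, h3⟩ | ⟨-, h2, h3⟩
  · have i1 := M.logD_lt h2 vx vz' vz vw
    have i2 := M.logD_lt h3 vz vy vz' vw
    have s1 := s z y
    have := le_abs_self (M.logD v y z + M.logD v x z' - M.logD v x z - M.logD v y z')
    exact max_le (abs_le.2 ⟨by linarith, by linarith⟩) (abs_le.2 ⟨by linarith, by linarith⟩)
  · have i1 := M.logD_lt h2 vx vz vz' vw
    have i2 := M.logD_lt h3 vz' vy vz vw
    have s1 := s z' y
    have := neg_abs_le (M.logD v y z + M.logD v x z' - M.logD v x z - M.logD v y z')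
    exact max_le (abs_le.2 ⟨by linarith, by linarith⟩) (abs_le.2 ⟨by linarith, by linarith⟩)

end Potential

section LowerBound

variable {X : Type*} [CircularOrder X] [TopologicalSpace X] {M : MonotoneMobius X}

/-- The harmonic pair with the two axes exchanged. -/
def HarmPt.swap (q : HarmPt M) : HarmPt M where
  x := q.z
  y := q.u
  z := q.x
  u := q.y
  hxy := q.hzu
  hxz := q.hxz.symm
  hxu := q.hyz.symm
  hyz := q.hxu.symm
  hyu := q.hyu.symm
  hzu := q.hxy
  harm := q.harm.swap

/-- The harmonic pair with the ends of the left axis exchanged. -/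
def HarmPt.swapLeft (q : HarmPt M) : HarmPt M where
  x := q.y
  y := q.x
  z := q.z
  u := q.u
  hxy := q.hxy.symm
  hxz := q.hyz
  hxu := q.hyu
  hyz := q.hxz
  hyu := q.hxu
  hzu := q.hzu
  harm := fun w wx wy wz wu => by linarith [q.harm w wy wx wz wu]

/-- The harmonic pair with the ends of the right axis exchanged. -/
def HarmPt.swapRight (q : HarmPt M) : HarmPt M := q.swap.swapLeft.swap

/-- No point of the harmonic pair `q` equals `v`. -/
def HarmPt.Avoids (q : HarmPt M) (v : X) : Prop := q.x ≠ v ∧ q.y ≠ v ∧ q.z ≠ v ∧ q.u ≠ v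

/-- The potential at a harmonic pair. -/
noncomputable def HarmPt.potential (v w : X) (q : HarmPt M) : ℝ :=
  M.potential v w q.x q.y q.z q.u

theorem HarmPt.separates (q : HarmPt M) : PairSeparates q.x q.y q.z q.u :=
  q.harm.pairSeparates q.hxy q.hxz q.hxu q.hyz q.hyu q.hzu

theorem HarmPt.logD_eq (q : HarmPt M) {v : X} (hv : q.Avoids v) :
    M.logD v q.x q.z + M.logD v q.y q.u = M.logD v q.x q.u + M.logD v q.y q.z :=
  q.harm.logD_eq q.hxz q.hxu q.hyz q.hyu hv.1 hv.2.1 hv.2.2.1 hv.2.2.2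

theorem stepDistL_eq {v : X} {q q' : HarmPt M} (hv : q.Avoids v) (hv' : q'.Avoids v)
    (h : leftAxisEq q q') : stepDistL q q' =
      |M.logD v q.y q.z + M.logD v q.x q'.z - M.logD v q.x q.z - M.logD v q.y q'.z| := by
  have hx : q.x ≠ q'.z := by
    rcases h with ⟨h, -⟩ | ⟨h, -⟩ <;> rw [h]
    exacts [q'.hxz, q'.hyz]
  have hy : q.y ≠ q'.z := by
    rcases h with ⟨-, h⟩ | ⟨-, h⟩ <;> rw [h]
    exacts [q'.hyz, q'.hxz]
  exact M.lineDist_eq q.hxy q.hxz hx q.hyz hy hv.1 hv.2.1 hv.2.2.1 hv'.2.2.1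

theorem HarmPt.Avoids.swap {q : HarmPt M} {v : X} (h : q.Avoids v) : q.swap.Avoids v :=
  ⟨h.2.2.1, h.2.2.2, h.1, h.2.1⟩

theorem HarmPt.potential_swap (v w : X) (q : HarmPt M) :
    q.swap.potential v w = q.potential v w := M.potential_swap v w _ _ _ _

theorem HarmPt.potential_swapLeft (v w : X) (q : HarmPt M) :
    q.swapLeft.potential v w = q.potential v w := M.potential_swap_left v w _ _ _ _

theorem HarmPt.potential_swapRight (v w : X) (q : HarmPt M) :
    q.swapRight.potential v w = q.potential v w := M.potential_swap_right v w _ _ _ _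

theorem HarmPt.Avoids.swapLeft {q : HarmPt M} {v : X} (h : q.Avoids v) : q.swapLeft.Avoids v :=
  ⟨h.2.1, h.1, h.2.2⟩

theorem HarmPt.Avoids.swapRight {q : HarmPt M} {v : X} (h : q.Avoids v) :
    q.swapRight.Avoids v := h.swap.swapLeft.swap

theorem HarmPt.potential_of_left_eq {v : X} (q : HarmPt M) (hv : q.Avoids v) :
    q.potential v q.x = M.logD v q.x q.y + M.logD v q.x q.z - M.logD v q.y q.z :=
  q.harm.potential_of_mem q.hxy q.hxz q.hyz q.hyu hv.1 hv.2.1 hv.2.2.1 hv.2.2.2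

/-- The variation of the potential at an end of the axis is the length of the segment. -/
theorem abs_potential_sub_eq_stepDistL {v : X} {q q' : HarmPt M} (hv : q.Avoids v)
    (hv' : q'.Avoids v) (h : leftAxisEq q q') :
    |q.potential v q.x - q'.potential v q.x| = stepDistL q q' := by
  rw [stepDistL_eq hv hv' h, q.potential_of_left_eq hv]
  have : q'.potential v q.x = M.logD v q.x q.y + M.logD v q.x q'.z - M.logD v q.y q'.z := by
    rcases h with ⟨h1, h2⟩ | ⟨h1, h2⟩
    · rw [h1, h2, q'.potential_of_left_eq hv']
    · rw [h1, h2, ← q'.potential_swapLeft]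
      exact q'.swapLeft.potential_of_left_eq hv'.swapLeft
  rw [this, ← abs_neg]
  congr 1; ring

theorem abs_potential_sub_le_stepDistL {v w : X} {q q' : HarmPt M} (hv : q.Avoids v)
    (hv' : q'.Avoids v) (vw : w ≠ v) (h : leftAxisEq q q') :
    |q.potential v w - q'.potential v w| ≤ stepDistL q q' := by
  wlog h' : q.x = q'.x ∧ q.y = q'.y generalizing q'
  · have h := h.resolve_left h'
    have := this (q' := q'.swapLeft) hv'.swapLeft (Or.inl h) h
    rwa [q'.potential_swapLeft] at this
  obtain ⟨hx, hy⟩ := h'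
  by_cases wx : w = q.x
  · rw [wx, abs_potential_sub_eq_stepDistL hv hv' h]
  by_cases wy : w = q.y
  · have := abs_potential_sub_eq_stepDistL (q := q.swapLeft) (q' := q'.swapLeft) hv.swapLeft
      hv'.swapLeft (Or.inl ⟨hy, hx⟩)
    rw [q.potential_swapLeft, q'.potential_swapLeft] at this
    rw [wy]
    refine this.le.trans ?_
    rw [stepDistL_eq hv.swapLeft hv'.swapLeft (Or.inl ⟨hy, hx⟩), stepDistL_eq hv hv' h,
      ← abs_neg]
    refine le_of_eq ?_
    congr 1
    simp only [HarmPt.swapLeft]; ring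
  have key : ∀ p : HarmPt M, p.Avoids v → p.x = q.x → p.y = q.y →
      ∃ z, PairSeparates q.x q.y z w ∧ z ≠ v ∧ p.potential v w =
          max (M.logD v q.x w + M.logD v z w - M.logD v q.x z)
            (M.logD v q.y w + M.logD v z w - M.logD v q.y z) ∧
        M.logD v q.y z - M.logD v q.x z = M.logD v q.y p.z - M.logD v q.x p.z := by
    intro p hp px py
    have e := p.logD_eq hp
    rw [← px, ← py]
    rw [← px] at wx
    rw [← py] at wy
    rcases p.separates.separates_or p.hxy wx wy with hs | hs
    · exact ⟨p.z, hs, hp.2.2.1, p.harm.potential_of_separates p.separates hs hp.1 hp.2.1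
        hp.2.2.1 hp.2.2.2 vw, rfl⟩
    · refine ⟨p.u, hs, hp.2.2.2, ?_, by linarith⟩
      rw [← p.potential_swapRight]
      exact p.swapRight.harm.potential_of_separates p.swapRight.separates hs hp.1 hp.2.1
        hp.2.2.2 hp.2.2.1 vw
  obtain ⟨z, hz, vz, e, r⟩ := key q hv rfl rfl
  obtain ⟨z', hz', vz', e', r'⟩ := key q' hv' hx.symm hy.symm
  rw [e, e', stepDistL_eq hv hv' h]
  convert MonotoneMobius.abs_max_sub_max_le_of_separates hz hz' hv.1 hv.2.1 vz vz' vw using 2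
  linarith

theorem leftAxisEq_swap {q q' : HarmPt M} (h : rightAxisEq q q') :
    leftAxisEq q.swap q'.swap := h

theorem ZZ.exists_abs_potential_sub_le {w : X} {q q' : HarmPt M} {b : Bool} {n : ℕ} {L : ℝ}
    (h : ZZ q q' b n L) : ∃ S : Finset X, ∀ v, (∀ s ∈ S, v ≠ s) →
      |q.potential v w - q'.potential v w| ≤ L := by
  have avoid : ∀ {q : HarmPt M} {v : X}, (∀ s ∈ ({q.x, q.y, q.z, q.u} : Finset X), v ≠ s) →
      q.Avoids v := fun h =>
    ⟨(h _ (by simp)).symm, (h _ (by simp)).symm, (h _ (by simp)).symm, (h _ (by simp)).symm⟩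
  induction h with
  | nil q b => exact ⟨∅, fun v _ => by simp⟩
  | @left q q' qe n L hne hax rest ih =>
    obtain ⟨S, hS⟩ := ih
    refine ⟨S ∪ {w} ∪ {q.x, q.y, q.z, q.u} ∪ {q'.x, q'.y, q'.z, q'.u}, fun v hv => ?_⟩
    simp only [Finset.forall_mem_union] at hv
    obtain ⟨⟨⟨h1, h2⟩, h3⟩, h4⟩ := hv
    have i1 := hS v h1
    have i2 := abs_potential_sub_le_stepDistL (avoid h3) (avoid h4) (h2 w (by simp)).symm hax
    exact (abs_sub_le _ _ _).trans (add_le_add i2 i1)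
  | @right q q' qe n L hne hax rest ih =>
    obtain ⟨S, hS⟩ := ih
    refine ⟨S ∪ {w} ∪ {q.x, q.y, q.z, q.u} ∪ {q'.x, q'.y, q'.z, q'.u}, fun v hv => ?_⟩
    simp only [Finset.forall_mem_union] at hv
    obtain ⟨⟨⟨h1, h2⟩, h3⟩, h4⟩ := hv
    have i1 := hS v h1
    have i2 := abs_potential_sub_le_stepDistL (avoid h3).swap (avoid h4).swap
      (h2 w (by simp)).symm (leftAxisEq_swap hax)
    rw [q.potential_swap, q'.potential_swap] at i2
    exact (abs_sub_le _ _ _).trans (add_le_add i2 i1)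

/-- A zig-zag path between two points of a left line is not shorter than the segment. -/
theorem ZZ.stepDistL_le {q q' : HarmPt M} {b : Bool} {n : ℕ} {L : ℝ} (h : ZZ q q' b n L)
    (hax : leftAxisEq q q') : stepDistL q q' ≤ L := by
  obtain ⟨S, hS⟩ := h.exists_abs_potential_sub_le (w := q.x)
  obtain ⟨v, hv⟩ := M.exists_forall_ne (S ∪ {q.x, q.y, q.z, q.u} ∪ {q'.x, q'.y, q'.z, q'.u})
  simp only [Finset.forall_mem_union, Finset.mem_insert, Finset.mem_singleton, forall_eq_or_imp,
    forall_eq] at hv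
  obtain ⟨⟨h1, h2, h3, h4, h5⟩, h6, h7, h8, h9⟩ := hv
  rw [← abs_potential_sub_eq_stepDistL ⟨h2.symm, h3.symm, h4.symm, h5.symm⟩
    ⟨h6.symm, h7.symm, h8.symm, h9.symm⟩ hax]
  exact hS v h1

end LowerBound

section Hexagon

open Set Filter Topology

/-- A strictly monotone family of functions changing sign has a continuous family of zeros. -/
theorem exists_continuousOn_zero {K : Set ℝ} {f : ℝ → ℝ → ℝ} {a b : ℝ} (hab : a < b)
    (hmono : ∀ t ∈ K, StrictMonoOn (f t) (Icc a b))
    (hcont : ∀ t ∈ K, ContinuousOn (f t) (Icc a b))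
    (hcont' : ∀ s ∈ Icc a b, ContinuousOn (fun t => f t s) K)
    (ha : ∀ t ∈ K, f t a < 0) (hb : ∀ t ∈ K, 0 < f t b) :
    ∃ ρ : ℝ → ℝ, ContinuousOn ρ K ∧ ∀ t ∈ K, ρ t ∈ Ioo a b ∧ f t (ρ t) = 0 := by
  have h : ∀ t ∈ K, ∃ s ∈ Ioo a b, f t s = 0 := fun t ht =>
    intermediate_value_Ioo hab.le (hcont t ht) ⟨ha t ht, hb t ht⟩
  choose! ρ hρ hρ' using h
  refine ⟨ρ, fun t ht => tendsto_order.2 ⟨fun c hc => ?_, fun c hc => ?_⟩,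
    fun t ht => ⟨hρ t ht, hρ' t ht⟩⟩
  · by_cases hac : a ≤ c
    · have hcI : c ∈ Icc a b := ⟨hac, (hc.trans (hρ t ht).2).le⟩
      have h1 : f t c < 0 := by
        rw [← hρ' t ht]; exact hmono t ht hcI (Ioo_subset_Icc_self (hρ t ht)) hc
      filter_upwards [(hcont' c hcI t ht).eventually (gt_mem_nhds h1), self_mem_nhdsWithin]
        with s hs hsK
      rw [← hρ' s hsK] at hs
      exact ((hmono s hsK).lt_iff_lt hcI (Ioo_subset_Icc_self (hρ s hsK))).1 hs
    · filter_upwards [self_mem_nhdsWithin] with s hsK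
      exact (not_le.1 hac).trans (hρ s hsK).1
  · by_cases hcb : c ≤ b
    · have hcI : c ∈ Icc a b := ⟨((hρ t ht).1.trans hc).le, hcb⟩
      have h1 : 0 < f t c := by
        rw [← hρ' t ht]; exact hmono t ht (Ioo_subset_Icc_self (hρ t ht)) hcI hc
      filter_upwards [(hcont' c hcI t ht).eventually (lt_mem_nhds h1), self_mem_nhdsWithin]
        with s hs hsK
      rw [← hρ' s hsK] at hs
      exact ((hmono s hsK).lt_iff_lt (Ioo_subset_Icc_self (hρ s hsK)) hcI).1 hs
    · filter_upwards [self_mem_nhdsWithin] with s hsK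
      exact (hρ s hsK).2.trans (not_le.1 hcb)

/-- The properties of `ℓ s t = ln |st|` in a real coordinate `A < s < B` on the circle minus
the infinitely remote point: continuity, and monotonicity of cross-ratios. -/
structure MonotoneLog (A B : ℝ) (ℓ : ℝ → ℝ → ℝ) : Prop where
  cont : ∀ {s t : ℝ}, A < s → s < t → t < B →
    ContinuousAt (fun p : ℝ × ℝ => ℓ p.1 p.2) (s, t)
  lt_outer : ∀ {p q r s : ℝ}, A < p → p < q → q < r → r < s → s < B →
    ℓ p s + ℓ q r < ℓ p r + ℓ q s
  lt_side : ∀ {p q r s : ℝ}, A < p → p < q → q < r → r < s → s < B →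
    ℓ p q + ℓ r s < ℓ p r + ℓ q s

/-- The logarithmic defect of harmonicity of the pairs `(x,y)` and `(z,u)`, where
`x < z < y < u`. -/
def harmDefect (ℓ : ℝ → ℝ → ℝ) (x y z u : ℝ) : ℝ := ℓ x z + ℓ y u - ℓ x u - ℓ z y

/-- The length of the segment with ends `z < w` on a line with axis `(x,y)`,
where `x < z` and `w < y`. -/
def innerLength (ℓ : ℝ → ℝ → ℝ) (x y z w : ℝ) : ℝ := ℓ x w + ℓ z y - ℓ x z - ℓ w y

/-- The length of the segment with ends `x < w` on a line with axis `(z,u)`,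
where `w < z < u`. -/
def outerLength (ℓ : ℝ → ℝ → ℝ) (z u x w : ℝ) : ℝ := ℓ x z + ℓ w u - ℓ x u - ℓ w z

namespace MonotoneLog

variable {A B : ℝ} {ℓ : ℝ → ℝ → ℝ}

theorem contAt (h : MonotoneLog A B ℓ) {f g : ℝ → ℝ} {t : ℝ} (hf : ContinuousAt f t)
    (hg : ContinuousAt g t) (h1 : A < f t) (h2 : f t < g t) (h3 : g t < B) :
    ContinuousAt (fun s => ℓ (f s) (g s)) t :=
  ContinuousAt.comp (f := fun s => (f s, g s)) (h.cont h1 h2 h3) (hf.prodMk hg)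

theorem harmDefect_contAt (h : MonotoneLog A B ℓ) {x y z u : ℝ → ℝ} {t : ℝ}
    (hx : ContinuousAt x t) (hy : ContinuousAt y t) (hz : ContinuousAt z t)
    (hu : ContinuousAt u t) (h0 : A < x t) (h1 : x t < z t) (h2 : z t < y t) (h3 : y t < u t)
    (h4 : u t < B) : ContinuousAt (fun s => harmDefect ℓ (x s) (y s) (z s) (u s)) t :=
  (((h.contAt hx hz h0 h1 (by linarith)).add (h.contAt hy hu (by linarith) h3 h4)).sub
    (h.contAt hx hu h0 (by linarith) h4)).sub (h.contAt hz hy (by linarith) h2 (by linarith))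

theorem harmDefect_lt_of_lt_x (h : MonotoneLog A B ℓ) {x x' y z u : ℝ} (h0 : A < x)
    (h1 : x < x') (h2 : x' < z) (h3 : z < y) (h4 : y < u) (h5 : u < B) :
    harmDefect ℓ x' y z u < harmDefect ℓ x y z u := by
  have := h.lt_outer h0 h1 h2 (h3.trans h4) h5
  simp only [harmDefect]; linarith

theorem harmDefect_lt_of_lt_y (h : MonotoneLog A B ℓ) {x y y' z u : ℝ} (h0 : A < x)
    (h1 : x < z) (h2 : z < y) (h3 : y < y') (h4 : y' < u) (h5 : u < B) :
    harmDefect ℓ x y' z u < harmDefect ℓ x y z u := by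
  have := h.lt_side (h0.trans h1) h2 h3 h4 h5
  simp only [harmDefect]; linarith

theorem harmDefect_lt_of_lt_z (h : MonotoneLog A B ℓ) {x y z z' u : ℝ} (h0 : A < x)
    (h1 : x < z) (h2 : z < z') (h3 : z' < y) (h4 : y < u) (h5 : u < B) :
    harmDefect ℓ x y z u < harmDefect ℓ x y z' u := by
  have := h.lt_side h0 h1 h2 h3 (h4.trans h5)
  simp only [harmDefect]; linarith

theorem harmDefect_lt_of_lt_u (h : MonotoneLog A B ℓ) {x y z u u' : ℝ} (h0 : A < x)
    (h1 : x < z) (h2 : z < y) (h3 : y < u) (h4 : u < u') (h5 : u' < B) :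
    harmDefect ℓ x y z u < harmDefect ℓ x y z u' := by
  have := h.lt_outer h0 (h1.trans h2) h3 h4 h5
  simp only [harmDefect]; linarith

/-- Comparison of an outer pair `(x,y)` with an inner pair `(x',y')`. -/
theorem harmDefect_add_lt (h : MonotoneLog A B ℓ) {x x' y y' z z' u u' : ℝ} (h0 : A < x)
    (h1 : x < x') (h2 : x' < z) (h3 : z < z') (h4 : z' < y') (h5 : y' < y) (h6 : y < u')
    (h7 : u' < u) (h8 : u < B) :
    harmDefect ℓ x' y' z u + harmDefect ℓ x y z' u' <
      harmDefect ℓ x y z u + harmDefect ℓ x' y' z' u' := by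
  have a1 := h.lt_outer h0 h1 h2 h3 (by linarith)
  have a2 := h.lt_outer (by linarith) h3 h4 h5 (by linarith)
  have a3 := h.lt_outer (by linarith) h5 h6 h7 h8
  have a4 := h.lt_outer h0 h1 (by linarith) h7 h8
  have a5 := h.lt_side h0 h1 h2 h3 (by linarith)
  have a6 := h.lt_side (by linarith) h3 h4 h5 (by linarith)
  have a7 := h.lt_side (by linarith) h5 h6 h7 h8
  have a8 := h.lt_side h0 h1 (by linarith) h7 h8
  simp only [harmDefect]; linarith

theorem innerLength_lt (h : MonotoneLog A B ℓ) {x x' y y' z z' t t' : ℝ} (h0 : A < x)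
    (h1 : x < x') (h2 : x' < z) (h3 : z ≤ t) (h4 : t < t') (h5 : t' ≤ z') (h6 : z' < y')
    (h7 : y' < y) (h8 : y < B) : innerLength ℓ x y t t' < innerLength ℓ x' y' z z' := by
  have a1 := h.lt_outer h0 h1 (h2.trans_le h3) h4 (by linarith)
  have a2 := h.lt_outer (by linarith) h4 (h5.trans_lt h6) h7 h8
  have a3 : ℓ x' z + ℓ t y' ≤ ℓ x' t + ℓ z y' := by
    rcases h3.eq_or_lt with rfl | h3
    · exact le_rfl
    · exact (h.lt_side (by linarith) h2 h3 (by linarith) (by linarith)).le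
  have a4 : ℓ x' t' + ℓ z' y' ≤ ℓ x' z' + ℓ t' y' := by
    rcases h5.eq_or_lt with rfl | h5
    · exact le_rfl
    · exact (h.lt_side (by linarith) (by linarith) h5 h6 (by linarith)).le
  simp only [innerLength]; linarith

theorem innerLength_pos (h : MonotoneLog A B ℓ) {x y z z' : ℝ} (h0 : A < x)
    (h1 : x < z) (h2 : z < z') (h3 : z' < y) (h4 : y < B) : 0 < innerLength ℓ x y z z' := by
  have := h.lt_side h0 h1 h2 h3 h4
  simp only [innerLength]; linarith

theorem outerLength_pos (h : MonotoneLog A B ℓ) {x x' z u : ℝ} (h0 : A < x)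
    (h1 : x < x') (h2 : x' < z) (h3 : z < u) (h4 : u < B) : 0 < outerLength ℓ z u x x' := by
  have := h.lt_outer h0 h1 h2 h3 h4
  simp only [outerLength]; linarith

theorem outerLength_lt (h : MonotoneLog A B ℓ) {x x' z z' u u' : ℝ} (h0 : A < x)
    (h1 : x < x') (h2 : x' < z) (h3 : z ≤ z') (h4 : z' < u') (h5 : u' < u) (h6 : u < B) :
    outerLength ℓ z' u' x x' < outerLength ℓ z u x x' := by
  have a1 := h.lt_outer h0 h1 (by linarith) h5 h6
  have a2 : ℓ x z' + ℓ x' z ≤ ℓ x z + ℓ x' z' := by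
    rcases h3.eq_or_lt with rfl | h3
    · exact le_rfl
    · exact (h.lt_outer h0 h1 h2 h3 (by linarith)).le
  simp only [outerLength]; linarith

theorem eventually_innerLength_lt (h : MonotoneLog A B ℓ) {x y z ε : ℝ} (h0 : A < x)
    (h1 : x < z) (h2 : z < y) (h3 : y < B) (hε : 0 < ε) :
    ∀ᶠ t in 𝓝 z, innerLength ℓ x y z t < ε := by
  have c : ContinuousAt (fun t => innerLength ℓ x y z t) z :=
    (((h.contAt continuousAt_const continuousAt_id h0 h1 (h2.trans h3)).add
      continuousAt_const).sub continuousAt_const).sub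
        (h.contAt continuousAt_id continuousAt_const (h0.trans h1) h2 h3)
  refine c.eventually (gt_mem_nhds ?_)
  simpa [innerLength] using hε

theorem eventually_outerLength_lt (h : MonotoneLog A B ℓ) {x z u ε : ℝ} (h0 : A < x)
    (h1 : x < z) (h2 : z < u) (h3 : u < B) (hε : 0 < ε) :
    ∀ᶠ t in 𝓝 x, outerLength ℓ z u x t < ε ∧ outerLength ℓ z u t x < ε := by
  have c1 : ContinuousAt (fun t => ℓ t z) x :=
    h.contAt continuousAt_id continuousAt_const h0 h1 (h2.trans h3)
  have c2 : ContinuousAt (fun t => ℓ t u) x :=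
    h.contAt continuousAt_id continuousAt_const h0 (h1.trans h2) h3
  have c : ContinuousAt (fun t => outerLength ℓ z u x t) x :=
    ((continuousAt_const.add c2).sub continuousAt_const).sub c1
  have c' : ContinuousAt (fun t => outerLength ℓ z u t x) x :=
    ((c1.add continuousAt_const).sub c2).sub continuousAt_const
  refine (c.eventually (gt_mem_nhds ?_)).and (c'.eventually (gt_mem_nhds ?_)) <;>
    simpa [outerLength] using hε

/-- Every harmonic pair is a vertex of arbitrarily small closed harmonic hexagons. -/
theorem exists_hexagon (h : MonotoneLog A B ℓ) {x y z u ε : ℝ} (hx : A < x) (hxz : x < z)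
    (hzy : z < y) (hyu : y < u) (hu : u < B) (hH : harmDefect ℓ x y z u = 0) (hε : 0 < ε) :
    ∃ x₂ x₃ y₂ y₃ z₁ z₂ u₁ u₂ : ℝ, A < x₃ ∧ x₃ < x ∧ x < x₂ ∧ x₂ < z ∧ z < z₂ ∧ z₂ < z₁ ∧
      z₁ < y₂ ∧ y₂ < y ∧ y < y₃ ∧ y₃ < u₁ ∧ u₁ < B ∧ y₃ < u ∧ y₃ < u₂ ∧ u₂ < B ∧
      harmDefect ℓ x y z₁ u₁ = 0 ∧ harmDefect ℓ x₂ y₂ z₁ u₁ = 0 ∧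
      harmDefect ℓ x₂ y₂ z₂ u₂ = 0 ∧ harmDefect ℓ x₃ y₃ z₂ u₂ = 0 ∧
      harmDefect ℓ x₃ y₃ z u = 0 ∧
      innerLength ℓ x y z z₁ < ε ∧ outerLength ℓ z₁ u₁ x x₂ < ε ∧
      innerLength ℓ x₂ y₂ z₂ z₁ < ε ∧ outerLength ℓ z₂ u₂ x₃ x₂ < 2 * ε ∧
      innerLength ℓ x₃ y₃ z z₂ < ε ∧ outerLength ℓ z u x₃ x < ε := by
  obtain ⟨um, hyum, humu⟩ := exists_between hyu
  obtain ⟨up, huup, hupB⟩ := exists_between hu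
  obtain ⟨ym, hzym, hymy⟩ := exists_between hzy
  have c0 : ∀ {a t : ℝ}, ContinuousAt (fun _ : ℝ => a) t := by
    intro a t; exact continuousAt_const
  have c1 : ∀ {t : ℝ}, ContinuousAt (fun s : ℝ => s) t := by
    intro t; exact continuousAt_id
  have Hp : 0 < harmDefect ℓ x y z up := hH ▸ h.harmDefect_lt_of_lt_u hx hxz hzy hyu huup hupB
  have Hm : harmDefect ℓ x y z um < 0 := hH ▸ h.harmDefect_lt_of_lt_u hx hxz hzy hyum humu hu
  obtain ⟨yp, Hyp, hyyp, hypum⟩ := ((((h.harmDefect_contAt (c0 (a := x)) c1 (c0 (a := z))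
    (c0 (a := up)) hx hxz hzy (hyu.trans huup) hupB).eventually (lt_mem_nhds Hp)).filter_mono
      nhdsWithin_le_nhds).and (Ioo_mem_nhdsGT hyum)).exists
  obtain ⟨xp, Hxp, hxxp, hxpz⟩ := ((((h.harmDefect_contAt c1 (c0 (a := yp)) (c0 (a := z))
    (c0 (a := up)) hx hxz (hzy.trans hyyp) (by linarith) hupB).eventually
      (lt_mem_nhds Hyp)).filter_mono nhdsWithin_le_nhds).and (Ioo_mem_nhdsGT hxz)).exists
  -- choice of the second right axis
  obtain ⟨z₁, ⟨Hz₁, Iz₁⟩, hzz₁, hz₁ym⟩ := (((((h.harmDefect_contAt (c0 (a := x)) (c0 (a := y)) c1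
    (c0 (a := um)) hx hxz hzy hyum (humu.trans hu)).eventually (gt_mem_nhds Hm)).and
      (h.eventually_innerLength_lt (hx.trans hxxp) hxpz hzym (by linarith) hε)).filter_mono
      nhdsWithin_le_nhds).and (Ioo_mem_nhdsGT hzym)).exists
  have Hz₁p : 0 < harmDefect ℓ x y z₁ up :=
    Hp.trans (h.harmDefect_lt_of_lt_z hx hxz hzz₁ (by linarith) (hyu.trans huup) hupB)
  have Hz₁u : 0 < harmDefect ℓ x y z₁ u :=
    hH ▸ h.harmDefect_lt_of_lt_z hx hxz hzz₁ (by linarith) hyu hu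
  obtain ⟨u₁, ⟨humu₁, hu₁u⟩, Hu₁⟩ := intermediate_value_Ioo humu.le
    (fun t ht => (h.harmDefect_contAt (c0 (a := x)) (c0 (a := y)) (c0 (a := z₁)) c1 hx
      (by linarith) (by linarith) (by linarith [ht.1])
      (by linarith [ht.2])).continuousWithinAt) ⟨Hz₁, Hz₁u⟩
  -- choice of the second left axis
  have Hym : 0 < harmDefect ℓ x ym z₁ u₁ :=
    Hu₁ ▸ h.harmDefect_lt_of_lt_y hx (by linarith) hz₁ym hymy (by linarith) (by linarith)
  have Hyp' : harmDefect ℓ x yp z u < 0 :=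
    hH ▸ h.harmDefect_lt_of_lt_y hx hxz hzy hyyp (by linarith) hu
  have hOut := h.eventually_outerLength_lt hx hxz (by linarith : z < up) hupB hε
  obtain ⟨x₂, ⟨Hx₂, Ox₂⟩, hxx₂, hx₂xp⟩ := (((((h.harmDefect_contAt c1 (c0 (a := ym))
    (c0 (a := z₁)) (c0 (a := u₁)) hx (by linarith) hz₁ym (by linarith)
      (by linarith)).eventually (lt_mem_nhds Hym)).and hOut).filter_mono
      nhdsWithin_le_nhds).and (Ioo_mem_nhdsGT hxxp)).exists
  have Hx₂y : harmDefect ℓ x₂ y z₁ u₁ < 0 :=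
    Hu₁ ▸ h.harmDefect_lt_of_lt_x hx hxx₂ (by linarith) (by linarith) (by linarith) (by linarith)
  obtain ⟨y₂, ⟨hymy₂, hy₂y⟩, Hy₂⟩ := intermediate_value_Ioo' hymy.le
    (fun t ht => (h.harmDefect_contAt (c0 (a := x₂)) c1 (c0 (a := z₁)) (c0 (a := u₁))
      (by linarith) (by linarith) (by linarith [ht.1]) (by linarith [ht.2])
      (by linarith)).continuousWithinAt) ⟨Hx₂y, Hx₂⟩
  -- choice of the third left axis
  obtain ⟨x₃, ⟨Hx₃, Ox₃⟩, hAx₃, hx₃x⟩ := (((((h.harmDefect_contAt c1 (c0 (a := yp))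
    (c0 (a := z)) (c0 (a := u)) hx hxz (by linarith) (by linarith) hu).eventually
      (gt_mem_nhds Hyp')).and hOut).filter_mono
      nhdsWithin_le_nhds).and (Ioo_mem_nhdsLT hx)).exists
  have Hx₃y : 0 < harmDefect ℓ x₃ y z u :=
    hH ▸ h.harmDefect_lt_of_lt_x hAx₃ hx₃x hxz hzy hyu hu
  obtain ⟨y₃, ⟨hyy₃, hy₃yp⟩, Hy₃⟩ := intermediate_value_Ioo' hyyp.le
    (fun t ht => (h.harmDefect_contAt (c0 (a := x₃)) c1 (c0 (a := z)) (c0 (a := u))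
      hAx₃ (by linarith) (by linarith [ht.1]) (by linarith [ht.2]) hu).continuousWithinAt)
      ⟨Hx₃, Hx₃y⟩
  -- the right axes harmonic to the second left axis
  have Hneg : harmDefect ℓ x₂ y₂ z₁ um < 0 :=
    Hy₂ ▸ h.harmDefect_lt_of_lt_u (by linarith) (by linarith) (by linarith) (by linarith)
      humu₁ (by linarith)
  have Hpos : 0 < harmDefect ℓ x₂ y₂ z up := by
    have a1 := h.harmDefect_lt_of_lt_x (y := yp) (z := z) (u := up) (by linarith) hx₂xp hxpz
      (by linarith) (by linarith) hupB
    have a2 := h.harmDefect_lt_of_lt_y (x := x₂) (y := y₂) (y' := yp) (z := z) (u := up)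
      (by linarith) (by linarith) (by linarith) (by linarith) (by linarith) hupB
    linarith
  obtain ⟨ρ, hρ, hρ'⟩ := exists_continuousOn_zero (K := Icc z z₁) (f := harmDefect ℓ x₂ y₂)
    (a := um) (b := up) (by linarith)
    (fun t ht a ha b hb hab => h.harmDefect_lt_of_lt_u (by linarith) (by linarith [ht.1])
      (by linarith [ht.2]) (by linarith [ha.1]) hab (by linarith [hb.2]))
    (fun t ht a ha => (h.harmDefect_contAt (c0 (a := x₂)) (c0 (a := y₂)) (c0 (a := t)) c1
      (by linarith) (by linarith [ht.1]) (by linarith [ht.2]) (by linarith [ha.1])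
      (by linarith [ha.2])).continuousWithinAt)
    (fun a ha t ht => (h.harmDefect_contAt (c0 (a := x₂)) (c0 (a := y₂)) c1 (c0 (a := a))
      (by linarith) (by linarith [ht.1]) (by linarith [ht.2]) (by linarith [ha.1])
      (by linarith [ha.2])).continuousWithinAt)
    (fun t ht => by
      rcases ht.2.eq_or_lt with rfl | ht'
      · exact Hneg
      · exact (h.harmDefect_lt_of_lt_z (by linarith) (by linarith [ht.1]) ht' (by linarith)
          (by linarith) (by linarith)).trans Hneg)
    (fun t ht => by
      rcases ht.1.eq_or_lt with rfl | ht'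
      · exact Hpos
      · exact Hpos.trans (h.harmDefect_lt_of_lt_z (by linarith) (by linarith) ht'
          (by linarith [ht.2]) (by linarith) (by linarith)))
  have mz : z ∈ Icc z z₁ := ⟨le_rfl, hzz₁.le⟩
  have mz₁ : z₁ ∈ Icc z z₁ := ⟨hzz₁.le, le_rfl⟩
  have hρz : u < ρ z := by
    have a1 := h.harmDefect_add_lt (u := u) (u' := u₁) hx hxx₂ (by linarith) hzz₁ (by linarith)
      hy₂y (by linarith) hu₁u hu
    have a2 := (hρ' z mz).2
    by_contra! hle
    rcases hle.eq_or_lt with hle | hle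
    · rw [hle] at a2; linarith
    · have := h.harmDefect_lt_of_lt_u (x := x₂) (y := y₂) (z := z) (by linarith) (by linarith)
        (by linarith) (by linarith [(hρ' z mz).1.1]) hle hu
      linarith
  have hρz₁ : ρ z₁ = u₁ := by
    obtain ⟨⟨b1, b2⟩, a2⟩ := hρ' z₁ mz₁
    rcases lt_trichotomy (ρ z₁) u₁ with hlt | heq | hlt
    · have := h.harmDefect_lt_of_lt_u (x := x₂) (y := y₂) (z := z₁) (by linarith) (by linarith)
        (by linarith) (by linarith) hlt (by linarith)
      linarith
    · exact heq
    · have := h.harmDefect_lt_of_lt_u (x := x₂) (y := y₂) (z := z₁) (by linarith) (by linarith)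
        (by linarith) (by linarith) hlt (by linarith)
      linarith
  have E1 : 0 < harmDefect ℓ x₃ y₃ z (ρ z) :=
    Hy₃ ▸ h.harmDefect_lt_of_lt_u hAx₃ (by linarith) (by linarith) (by linarith) hρz
      ((hρ' z mz).1.2.trans hupB)
  have E2 : harmDefect ℓ x₃ y₃ z₁ (ρ z₁) < 0 := by
    rw [hρz₁]
    have := h.harmDefect_add_lt (u := u) (u' := u₁) hAx₃ hx₃x hxz hzz₁ (by linarith)
      hyy₃ (by linarith) hu₁u hu
    linarith
  obtain ⟨z₂, ⟨hzz₂, hz₂z₁⟩, Hz₂⟩ := intermediate_value_Ioo' (f := fun t =>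
    harmDefect ℓ x₃ y₃ t (ρ t)) hzz₁.le (fun t ht => by
      have hcont : ContinuousOn (fun p : ℝ × ℝ => harmDefect ℓ x₃ y₃ p.1 p.2)
          (Ioo x₃ y₃ ×ˢ Ioo y₃ B) := fun p hp => by
        obtain ⟨⟨p1, p2⟩, p3, p4⟩ := hp
        have f1 : ContinuousAt (fun q : ℝ × ℝ => ℓ x₃ q.1) p :=
          ContinuousAt.comp (f := fun q : ℝ × ℝ => (x₃, q.1)) (h.cont hAx₃ p1 (by linarith))
            (continuousAt_const.prodMk continuousAt_fst)
        have f2 : ContinuousAt (fun q : ℝ × ℝ => ℓ y₃ q.2) p :=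
          ContinuousAt.comp (f := fun q : ℝ × ℝ => (y₃, q.2)) (h.cont (by linarith) p3 p4)
            (continuousAt_const.prodMk continuousAt_snd)
        have f3 : ContinuousAt (fun q : ℝ × ℝ => ℓ x₃ q.2) p :=
          ContinuousAt.comp (f := fun q : ℝ × ℝ => (x₃, q.2)) (h.cont hAx₃ (by linarith) p4)
            (continuousAt_const.prodMk continuousAt_snd)
        have f4 : ContinuousAt (fun q : ℝ × ℝ => ℓ q.1 y₃) p :=
          ContinuousAt.comp (f := fun q : ℝ × ℝ => (q.1, y₃)) (h.cont (by linarith) p2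
            (by linarith)) (continuousAt_fst.prodMk continuousAt_const)
        exact (((f1.add f2).sub f3).sub f4).continuousWithinAt
      exact (hcont.comp (continuousOn_id.prodMk hρ) (fun s hs => by
        have := (hρ' s hs).1
        exact ⟨⟨(by linarith [hs.1] : x₃ < s), (by linarith [hs.2] : s < y₃)⟩,
          by linarith [this.1], by linarith [this.2]⟩)) t ht) ⟨E2, E1⟩
  obtain ⟨⟨hu₂, hu₂'⟩, Hu₂⟩ := hρ' z₂ ⟨hzz₂.le, hz₂z₁.le⟩
  have O1 : ∀ {v w a b : ℝ}, A < a → a < b → b < z → z ≤ v → v < w → w < up →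
      outerLength ℓ v w a b < outerLength ℓ z up a b := fun e1 e2 e3 e4 e5 e6 =>
    h.outerLength_lt e1 e2 e3 e4 e5 e6 hupB
  have I1 : ∀ {a b s t : ℝ}, A < a → a < xp → z ≤ s → s < t → t ≤ z₁ → ym < b → b < B →
      innerLength ℓ a b s t < ε := fun e1 e2 e3 e4 e5 e6 e7 =>
    (h.innerLength_lt e1 e2 hxpz e3 e4 e5 hz₁ym e6 e7).trans Iz₁
  refine ⟨x₂, x₃, y₂, y₃, z₁, z₂, u₁, ρ z₂, hAx₃, hx₃x, hxx₂, by linarith, hzz₂, hz₂z₁,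
    by linarith, hy₂y, hyy₃, by linarith, by linarith, by linarith, by linarith, by linarith,
    Hu₁, Hy₂, Hu₂, Hz₂, Hy₃, ?_, ?_, ?_, ?_, ?_, ?_⟩
  · exact I1 hx hxxp le_rfl hzz₁ le_rfl hymy (by linarith)
  · exact (O1 hx hxx₂ (by linarith) hzz₁.le (by linarith) (by linarith)).trans Ox₂.1
  · exact I1 (by linarith) hx₂xp hzz₂.le hz₂z₁ le_rfl hymy₂ (by linarith)
  · have a1 := O1 (v := z₂) (w := ρ z₂) hAx₃ (by linarith : x₃ < x₂) (by linarith) hzz₂.le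
      (by linarith) hu₂'
    have a2 : outerLength ℓ z up x₃ x₂ = outerLength ℓ z up x₃ x + outerLength ℓ z up x x₂ := by
      simp only [outerLength]; ring
    linarith [Ox₂.1, Ox₃.2]
  · exact I1 hAx₃ (by linarith) le_rfl hzz₂ hz₂z₁.le (by linarith) (by linarith)
  · exact (O1 hAx₃ hx₃x hxz le_rfl (by linarith) huup).trans Ox₃.2

end MonotoneLog

end Hexagon

section Chart

open Set Filter Topology

variable {X : Type*} [CircularOrder X] [TopologicalSpace X] (M : MonotoneMobius X)

theorem MonotoneMobius.isOpen_ball {v x : X} (hx : x ≠ v) (r : ℝ) :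
    IsOpen {y | y ≠ v ∧ M.D v x y < r} := by
  have h := M.mtop
  have : IsOpen[MTopology M.D] {y | y ≠ v ∧ M.D v x y < r} :=
    TopologicalSpace.isOpen_generateFrom_of_mem ⟨v, x, r, hx, rfl⟩
  rwa [h] at this

theorem MonotoneMobius.tendsto_D {α : Type*} {l : Filter α} {f g : α → X} {v x y : X}
    (hx : x ≠ v) (hy : y ≠ v) (hf : Tendsto f l (𝓝 x)) (hg : Tendsto g l (𝓝 y)) :
    Tendsto (fun a => M.D v (f a) (g a)) l (𝓝 (M.D v x y)) := by
  rw [Metric.tendsto_nhds]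
  intro ε hε
  have ball : ∀ {x : X}, x ≠ v → {y | y ≠ v ∧ M.D v x y < ε / 2} ∈ 𝓝 x := fun {x} hx =>
    (M.isOpen_ball hx _).mem_nhds ⟨hx, by rw [M.refl]; positivity⟩
  filter_upwards [hf (ball hx), hg (ball hy)] with a ha hb
  obtain ⟨ha, ha'⟩ := ha
  obtain ⟨hb, hb'⟩ := hb
  have t1 := M.triangle ha hb hx
  have t2 := M.triangle hx hb hy
  have t3 := M.triangle hx hy ha
  have t4 := M.triangle ha hy hb
  rw [M.symm v (f a) x] at t1
  rw [M.symm v (g a) y] at t4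
  rw [Real.dist_eq, abs_lt]
  constructor <;> linarith

theorem MonotoneMobius.greatest_product {v p q r s : X} (hpq : p ≠ q) (hpr : p ≠ r)
    (hps : p ≠ s) (hqr : q ≠ r) (hqs : q ≠ s) (hrs : r ≠ s) (hp : p ≠ v) (hq : q ≠ v)
    (hr : r ≠ v) (hs : s ≠ v) :
    (max (M.D v p r * M.D v q s) (M.D v p s * M.D v q r) < M.D v p q * M.D v r s) ∨
    (max (M.D v p q * M.D v r s) (M.D v p s * M.D v q r) < M.D v p r * M.D v q s) ∨
    (max (M.D v p q * M.D v r s) (M.D v p r * M.D v q s) < M.D v p s * M.D v q r) := by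
  simp only [max_lt_iff]
  rcases pairSeparates_total hpq hpr hps hqr hqs hrs with h | h | h
  · exact Or.inl (M.mono v p q r s hp hq hr hs h)
  · have := M.mono v p r q s hp hr hq hs h
    rw [M.symm v r q] at this
    exact Or.inr (Or.inl this)
  · have := M.mono v p s q r hp hs hq hr h
    rw [M.symm v s r, M.symm v s q] at this
    exact Or.inr (Or.inr this)

/-- In an injective real coordinate, the greatest product of opposite distances is the one
prescribed by the order of the line. -/
theorem MonotoneMobius.max_lt_of_lt {v : X} {A B : ℝ} {g : ℝ → X} (hg : ContinuousOn g (Ioo A B))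
    (hinj : InjOn g (Ioo A B)) (hv : ∀ t ∈ Ioo A B, g t ≠ v) {p q r s : ℝ} (hp : A < p)
    (hpq : p < q) (hqr : q < r) (hrs : r < s) (hs : s < B) :
    max (M.D v (g p) (g q) * M.D v (g r) (g s)) (M.D v (g p) (g s) * M.D v (g q) (g r)) <
      M.D v (g p) (g r) * M.D v (g q) (g s) := by
  have ne : ∀ {a b : ℝ}, A < a → a < b → b < B → g a ≠ g b := fun h1 h2 h3 h =>
    h2.ne (hinj ⟨h1, by linarith⟩ ⟨by linarith, h3⟩ h)
  have nv : ∀ {a : ℝ}, A < a → a < B → g a ≠ v := fun h1 h2 => hv _ ⟨h1, h2⟩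
  have pos : ∀ {a b : ℝ}, A < a → a < b → b < B → 0 < M.D v (g a) (g b) := fun h1 h2 h3 =>
    M.pos v _ _ (ne h1 h2 h3) (nv h1 (by linarith)) (nv (by linarith) h3)
  have tri : ∀ t, p < t → t < r → _ := fun t h1 h2 => M.greatest_product (ne hp h1 (by linarith))
    (ne hp (by linarith) (by linarith)) (ne hp (by linarith) hs) (ne (by linarith) h2 (by linarith))
    (ne (by linarith) (h2.trans hrs) hs) (ne (by linarith) hrs hs) (nv hp (by linarith))
    (nv (by linarith) (by linarith)) (nv (by linarith) (by linarith)) (nv (by linarith) hs)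
  have c1 : ∀ {a : ℝ} {t : ℝ}, a ∈ Ioo A B → t ∈ Ioo A B →
      ContinuousAt (fun t => M.D v (g a) (g t)) t := fun ha ht =>
    M.tendsto_D (hv _ ha) (hv _ ht) tendsto_const_nhds (hg.continuousAt (isOpen_Ioo.mem_nhds ht))
  have c2 : ∀ {a : ℝ} {t : ℝ}, a ∈ Ioo A B → t ∈ Ioo A B →
      ContinuousAt (fun t => M.D v (g t) (g a)) t := fun ha ht =>
    M.tendsto_D (hv _ ht) (hv _ ha) (hg.continuousAt (isOpen_Ioo.mem_nhds ht)) tendsto_const_nhds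
  have mp : p ∈ Ioo A B := ⟨hp, by linarith⟩
  have mr : r ∈ Ioo A B := ⟨by linarith, by linarith⟩
  have ms : s ∈ Ioo A B := ⟨by linarith, hs⟩
  rcases tri q hpq hqr with h | h | h
  · exfalso
    obtain ⟨t, ⟨ht1, ht2⟩, ht⟩ := intermediate_value_Ioo (f := fun t =>
      M.D v (g p) (g t) * M.D v (g r) (g s) -
        max (M.D v (g p) (g r) * M.D v (g t) (g s)) (M.D v (g p) (g s) * M.D v (g t) (g r)))
      hpq.le (fun t ht => by
        have mt : t ∈ Ioo A B := ⟨by linarith [ht.1], by linarith [ht.2]⟩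
        exact (((c1 mp mt).mul continuousAt_const).sub ((continuousAt_const.mul (c2 ms mt)).max
          (continuousAt_const.mul (c2 mr mt)))).continuousWithinAt) (show (0 : ℝ) ∈ _ from by
        refine ⟨?_, sub_pos.2 h⟩
        simp only [M.refl, zero_mul, zero_sub, neg_lt_zero]
        exact lt_max_of_lt_left (mul_pos (pos hp (by linarith) (by linarith))
          (pos hp (by linarith) hs)))
    have ht := sub_eq_zero.1 ht
    rcases tri t ht1 (by linarith) with h' | h' | h'
    · exact h'.ne' ht
    · exact absurd (le_max_left _ _) (not_le.2 (ht ▸ (le_max_left _ _).trans_lt h'))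
    · exact absurd (le_max_right _ _) (not_le.2 (ht ▸ (le_max_left _ _).trans_lt h'))
  · exact h
  · exfalso
    obtain ⟨t, ⟨ht1, ht2⟩, ht⟩ := intermediate_value_Ioo' (f := fun t =>
      M.D v (g p) (g s) * M.D v (g t) (g r) -
        max (M.D v (g p) (g t) * M.D v (g r) (g s)) (M.D v (g p) (g r) * M.D v (g t) (g s)))
      hqr.le (fun t ht => by
        have mt : t ∈ Ioo A B := ⟨by linarith [ht.1], by linarith [ht.2]⟩
        exact ((continuousAt_const.mul (c2 mr mt)).sub (((c1 mp mt).mul continuousAt_const).max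
          (continuousAt_const.mul (c2 ms mt)))).continuousWithinAt) (show (0 : ℝ) ∈ _ from by
        refine ⟨?_, sub_pos.2 h⟩
        simp only [M.refl, mul_zero, zero_sub, neg_lt_zero]
        exact lt_max_of_lt_left (mul_pos (pos hp (by linarith) (by linarith))
          (pos (by linarith) hrs hs)))
    have ht := sub_eq_zero.1 ht
    rcases tri t (by linarith) ht2 with h' | h' | h'
    · exact absurd (le_max_left _ _) (not_le.2 (ht ▸ (le_max_right _ _).trans_lt h'))
    · exact absurd (le_max_right _ _) (not_le.2 (ht ▸ (le_max_right _ _).trans_lt h'))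
    · exact h'.ne' ht

theorem MonotoneMobius.monotoneLog {v : X} {A B : ℝ} {g : ℝ → X} (hg : ContinuousOn g (Ioo A B))
    (hinj : InjOn g (Ioo A B)) (hv : ∀ t ∈ Ioo A B, g t ≠ v) :
    MonotoneLog A B (fun s t => M.logD v (g s) (g t)) := by
  have pos : ∀ {a b : ℝ}, A < a → a < b → b < B → 0 < M.D v (g a) (g b) := fun h1 h2 h3 =>
    M.pos v _ _ (fun h => h2.ne (hinj ⟨h1, by linarith⟩ ⟨by linarith, h3⟩ h))
      (hv _ ⟨h1, by linarith⟩) (hv _ ⟨by linarith, h3⟩)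
  refine ⟨fun {s t} hs hst ht => ?_, fun {p q r s} hp hpq hqr hrs hs => ?_,
    fun {p q r s} hp hpq hqr hrs hs => ?_⟩
  · have ms : s ∈ Ioo A B := ⟨hs, by linarith⟩
    have mt : t ∈ Ioo A B := ⟨by linarith, ht⟩
    refine (Tendsto.log (M.tendsto_D (hv s ms) (hv t mt) ?_ ?_) (pos hs hst ht).ne')
    · exact (hg.continuousAt (isOpen_Ioo.mem_nhds ms)).tendsto.comp continuousAt_fst
    · exact (hg.continuousAt (isOpen_Ioo.mem_nhds mt)).tendsto.comp continuousAt_snd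
  all_goals
    have h := max_lt_iff.1 (M.max_lt_of_lt hg hinj hv hp hpq hqr hrs hs)
    have h1 := pos hp hpq (by linarith)
    have h2 := pos (a := p) (b := r) hp (by linarith) (by linarith)
    have h3 := pos (a := p) (b := s) hp (by linarith) hs
    have h4 := pos (a := q) (b := r) (by linarith) hqr (by linarith)
    have h5 := pos (a := q) (b := s) (by linarith) (by linarith) hs
    have h6 := pos (a := r) (b := s) (by linarith) hrs hs
    simp only [logD]
    rw [← Real.log_mul (by positivity) (by positivity),
      ← Real.log_mul (by positivity) (by positivity)]
  · exact Real.log_lt_log (by positivity) h.2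
  · exact Real.log_lt_log (by positivity) h.1

/-- The circle minus a point has a real coordinate. -/
theorem MonotoneMobius.exists_coordinate (M : MonotoneMobius X) (v : X) : ∃ (A B : ℝ) (g : ℝ → X),
    ContinuousOn g (Ioo A B) ∧ InjOn g (Ioo A B) ∧ (∀ t ∈ Ioo A B, g t ≠ v) ∧
      ∀ p, p ≠ v → ∃ t ∈ Ioo A B, g t = p := by
  obtain ⟨e⟩ := M.circle
  obtain ⟨a, ha⟩ := QuotientAddGroup.mk_surjective (e v)
  have : Fact ((0 : ℝ) < 1) := ⟨one_pos⟩
  let φ := AddCircle.openPartialHomeomorphCoe (1 : ℝ) a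
  have hs : φ.source = Ioo a (a + 1) := rfl
  have ht : φ.target = {(a : AddCircle (1 : ℝ))}ᶜ := rfl
  refine ⟨a, a + 1, fun t => e.symm (φ t), ?_, ?_, fun t h h' => ?_, fun p hp => ?_⟩
  · exact e.symm.continuous.comp_continuousOn φ.continuousOn
  · exact e.symm.injective.injOn.comp φ.injOn (mapsTo_univ _ _)
  · have := φ.map_source (hs ▸ h)
    rw [ht] at this
    apply this
    rw [← e.apply_symm_apply (φ t)]
    exact (congrArg e h').trans ha.symm
  · have hm : e p ∈ φ.target := by
      rw [ht]
      intro h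
      exact hp (e.injective (h.trans ha))
    exact ⟨φ.symm (e p), hs ▸ φ.map_target hm, by simp [φ.right_inv hm]⟩

end Chart

section SmallLoops

open Set

variable {X : Type*} [CircularOrder X] [TopologicalSpace X] {M : MonotoneMobius X}

theorem ZZ.swap {q q' : HarmPt M} {b : Bool} {n : ℕ} {L : ℝ} (h : ZZ q q' b n L) :
    ZZ q.swap q'.swap (!b) n L := by
  induction h with
  | nil q b => exact ZZ.nil _ _
  | @left q q' _ _ _ hne hax _ ih => exact ZZ.right (q := q.swap) (q' := q'.swap) hne hax ih
  | @right q q' _ _ _ hne hax _ ih => exact ZZ.left (q := q.swap) (q' := q'.swap) hne hax ih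

theorem zzDist_swap (q q' : HarmPt M) : zzDist q.swap q'.swap = zzDist q q' := by
  have : ∀ q q' : HarmPt M, zzDist q.swap q'.swap ≤ zzDist q q' := fun q q' =>
    sInf_le_sInf fun e ⟨r, b, n, h, he⟩ => ⟨r, !b, n, h.swap, he⟩
  exact le_antisymm (this q q') (this q.swap q'.swap)

theorem leftAxisEq.symm {q q' : HarmPt M} (h : leftAxisEq q q') : leftAxisEq q' q := by
  rcases h with ⟨h1, h2⟩ | ⟨h1, h2⟩
  · exact Or.inl ⟨h1.symm, h2.symm⟩
  · exact Or.inr ⟨h2.symm, h1.symm⟩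

theorem leftAxisEq.trans {q q' q'' : HarmPt M} (h : leftAxisEq q q') (h' : leftAxisEq q' q'') :
    leftAxisEq q q'' := by
  unfold leftAxisEq at *
  rcases h with ⟨h1, h2⟩ | ⟨h1, h2⟩ <;> rcases h' with ⟨h3, h4⟩ | ⟨h3, h4⟩ <;> simp_all

theorem rightAxisEq.symm {q q' : HarmPt M} (h : rightAxisEq q q') : rightAxisEq q' q :=
  (leftAxisEq_swap h).symm

theorem rightAxisEq.trans {q q' q'' : HarmPt M} (h : rightAxisEq q q')
    (h' : rightAxisEq q' q'') : rightAxisEq q q'' :=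
  (leftAxisEq_swap h).trans (leftAxisEq_swap h')

theorem stepDistL_eq_zero {q q' : HarmPt M} (hl : leftAxisEq q q') (hr : rightAxisEq q q') :
    stepDistL q q' = 0 := by
  obtain ⟨v, hv⟩ := M.exists_forall_ne {q.x, q.y, q.z, q.u, q'.x, q'.y, q'.z, q'.u}
  simp only [Finset.mem_insert, Finset.mem_singleton, forall_eq_or_imp, forall_eq] at hv
  obtain ⟨h2, h3, h4, h5, h6, h7, h8, h9⟩ := hv
  have hq : q.Avoids v := ⟨h2.symm, h3.symm, h4.symm, h5.symm⟩
  rw [stepDistL_eq hq ⟨h6.symm, h7.symm, h8.symm, h9.symm⟩ hl, abs_eq_zero]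
  rcases hr with ⟨h, -⟩ | ⟨-, h⟩ <;> rw [← h]
  · ring
  · linarith [q.logD_eq hq]

theorem potential_eq_of_axisEq {v w : X} {q q' : HarmPt M} (hv : q.Avoids v) (hv' : q'.Avoids v)
    (hw : w ≠ v) (hl : leftAxisEq q q') (hr : rightAxisEq q q') :
    q.potential v w = q'.potential v w := by
  have := abs_potential_sub_le_stepDistL hv hv' hw hl
  rw [stepDistL_eq_zero hl hr] at this
  exact sub_eq_zero.1 (abs_eq_zero.1 (le_antisymm this (abs_nonneg _)))

theorem stepDistL_le_of_axisEq {v : X} {p p' q q' : HarmPt M} (hp : p.Avoids v)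
    (hp' : p'.Avoids v) (hq : q.Avoids v) (hq' : q'.Avoids v) (hl : leftAxisEq q p)
    (hr : rightAxisEq q p) (hl' : leftAxisEq q' p') (hr' : rightAxisEq q' p')
    (h : leftAxisEq p p') : stepDistL q q' ≤ stepDistL p p' := by
  rw [← abs_potential_sub_eq_stepDistL hq hq' ((hl.trans h).trans hl'.symm),
    potential_eq_of_axisEq hq hp hq.1 hl hr, potential_eq_of_axisEq hq' hp' hq.1 hl' hr']
  exact abs_potential_sub_le_stepDistL hp hp' hq.1 h

theorem stepDistR_le_of_axisEq {v : X} {p p' q q' : HarmPt M} (hp : p.Avoids v)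
    (hp' : p'.Avoids v) (hq : q.Avoids v) (hq' : q'.Avoids v) (hl : leftAxisEq q p)
    (hr : rightAxisEq q p) (hl' : leftAxisEq q' p') (hr' : rightAxisEq q' p')
    (h : rightAxisEq p p') : stepDistR q q' ≤ stepDistR p p' :=
  stepDistL_le_of_axisEq hp.swap hp'.swap hq.swap hq'.swap hr hl hr' hl' (leftAxisEq_swap h)

theorem HarmPt.Avoids.of_axisEq {v : X} {p q : HarmPt M} (hp : p.Avoids v) (hl : leftAxisEq q p)
    (hr : rightAxisEq q p) : q.Avoids v := by
  obtain ⟨h1, h2, h3, h4⟩ := hp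
  unfold HarmPt.Avoids
  rcases hl with ⟨h5, h6⟩ | ⟨h5, h6⟩ <;> rcases hr with ⟨h7, h8⟩ | ⟨h7, h8⟩ <;>
    rw [h5, h6, h7, h8] <;> exact ⟨by assumption, by assumption, by assumption, by assumption⟩

/-- The ends of the axes of `q` have coordinates `x`, `y`, `z`, `u` with respect to `g`. -/
def HarmPt.HasCoords (g : ℝ → X) (q : HarmPt M) (x y z u : ℝ) : Prop :=
  q.x = g x ∧ q.y = g y ∧ q.z = g z ∧ q.u = g u

theorem HarmPt.HasCoords.stepDistL_eq {v : X} {g : ℝ → X} {q q' : HarmPt M}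
    {x y z u z' u' : ℝ} (h : q.HasCoords g x y z u) (h' : q'.HasCoords g x y z' u')
    (hv : q.Avoids v) (hv' : q'.Avoids v) :
    stepDistL q q' = |innerLength (fun s t => M.logD v (g s) (g t)) x y z z'| := by
  rw [_root_.stepDistL_eq hv hv' (Or.inl ⟨h.1.trans h'.1.symm, h.2.1.trans h'.2.1.symm⟩)]
  obtain ⟨h1, h2, h3, h4⟩ := h
  simp only [innerLength, h1, h2, h3, h'.2.2.1, M.logD_symm v (g y)]
  congr 1; ring

theorem HarmPt.HasCoords.stepDistR_eq {v : X} {g : ℝ → X} {q q' : HarmPt M}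
    {x y z u x' y' : ℝ} (h : q.HasCoords g x y z u) (h' : q'.HasCoords g x' y' z u)
    (hv : q.Avoids v) (hv' : q'.Avoids v) :
    stepDistR q q' = |outerLength (fun s t => M.logD v (g s) (g t)) z u x x'| := by
  obtain ⟨h1, h2, h3, h4⟩ := h
  obtain ⟨h5, h6, h7, h8⟩ := h'
  refine (_root_.stepDistL_eq hv.swap hv'.swap
    (Or.inl ⟨h3.trans h7.symm, h4.trans h8.symm⟩)).trans ?_
  rw [← abs_neg]
  simp only [outerLength, HarmPt.swap, h1, h3, h4, h5, M.logD_symm v (g u), M.logD_symm v (g z)]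
  congr 1; ring

theorem innerLength_swap (ℓ : ℝ → ℝ → ℝ) (x y z z' : ℝ) :
    innerLength ℓ x y z' z = -innerLength ℓ x y z z' := by
  simp only [innerLength]; ring

theorem outerLength_swap (ℓ : ℝ → ℝ → ℝ) (z u x x' : ℝ) :
    outerLength ℓ z u x' x = -outerLength ℓ z u x x' := by
  simp only [outerLength]; ring

theorem exists_hasCoords {v : X} {A B : ℝ} {g : ℝ → X} (hinj : InjOn g (Ioo A B))
    (hv : ∀ t ∈ Ioo A B, g t ≠ v) {x y z u : ℝ} (hx : A < x) (hxz : x < z) (hzy : z < y)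
    (hyu : y < u) (hu : u < B)
    (hH : harmDefect (fun s t => M.logD v (g s) (g t)) x y z u = 0) :
    ∃ q : HarmPt M, q.HasCoords g x y z u ∧ q.Avoids v := by
  have ne : ∀ {a b : ℝ}, A < a → a < b → b < B → g a ≠ g b := fun h1 h2 h3 h =>
    h2.ne (hinj ⟨h1, by linarith⟩ ⟨by linarith, h3⟩ h)
  have nv : ∀ {a : ℝ}, A < a → a < B → g a ≠ v := fun h1 h2 => hv _ ⟨h1, h2⟩
  have xz : g x ≠ g z := ne hx hxz (by linarith)
  have xy : g x ≠ g y := ne hx (by linarith) (by linarith)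
  have xu : g x ≠ g u := ne hx (by linarith) hu
  have zy : g z ≠ g y := ne (by linarith) hzy (by linarith)
  have zu : g z ≠ g u := ne (by linarith) (by linarith) hu
  have yu : g y ≠ g u := ne (by linarith) hyu hu
  have vx := nv hx (by linarith)
  have vy : g y ≠ v := nv (by linarith) (by linarith)
  have vz : g z ≠ v := nv (by linarith) (by linarith)
  have vu := nv (by linarith) hu
  refine ⟨⟨g x, g y, g z, g u, xy, xz, xu, zy.symm, yu, zu,
    M.harmonic_of_logD_eq xz xu zy.symm yu vx vy vz vu ?_⟩, ⟨rfl, rfl, rfl, rfl⟩, vx, vy, vz, vu⟩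
  simp only [harmDefect] at hH
  rw [M.logD_symm v (g y) (g z)]
  linarith

theorem HarmPt.HasCoords.not_rightAxisEq {A B : ℝ} {g : ℝ → X} (hinj : InjOn g (Ioo A B))
    {q q' : HarmPt M} {x y z u x' y' z' u' : ℝ} (h : q.HasCoords g x y z u)
    (h' : q'.HasCoords g x' y' z' u') (hz : z ∈ Ioo A B) (hz' : z' ∈ Ioo A B)
    (hu' : u' ∈ Ioo A B) (h1 : z ≠ z') (h2 : z ≠ u') : ¬ rightAxisEq q q' := by
  rintro (⟨e, -⟩ | ⟨e, -⟩)
  · exact h1 (hinj hz hz' (h.2.2.1.symm.trans (e.trans h'.2.2.1)))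
  · exact h2 (hinj hz hu' (h.2.2.1.symm.trans (e.trans h'.2.2.2)))

theorem HarmPt.HasCoords.not_leftAxisEq {A B : ℝ} {g : ℝ → X} (hinj : InjOn g (Ioo A B))
    {q q' : HarmPt M} {x y z u x' y' z' u' : ℝ} (h : q.HasCoords g x y z u)
    (h' : q'.HasCoords g x' y' z' u') (hx : x ∈ Ioo A B) (hx' : x' ∈ Ioo A B)
    (hy' : y' ∈ Ioo A B) (h1 : x ≠ x') (h2 : x ≠ y') : ¬ leftAxisEq q q' := by
  rintro (⟨e, -⟩ | ⟨e, -⟩)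
  · exact h1 (hinj hx hx' (h.1.symm.trans (e.trans h'.1)))
  · exact h2 (hinj hx hy' (h.1.symm.trans (e.trans h'.2.1)))

theorem HarmPt.HasCoords.exists_small_loop {v : X} {A B : ℝ} {g : ℝ → X}
    (hg : ContinuousOn g (Ioo A B)) (hinj : InjOn g (Ioo A B)) (hv : ∀ t ∈ Ioo A B, g t ≠ v)
    {p : HarmPt M} {x y z u : ℝ} (hp : p.HasCoords g x y z u) (hpv : p.Avoids v) (hx : A < x)
    (hxz : x < z) (hzy : z < y) (hyu : y < u) (hu : u < B) {q q' : HarmPt M}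
    (hl : leftAxisEq q p) (hr : rightAxisEq q p) (hl' : leftAxisEq q' p)
    (hr' : rightAxisEq q' p) {ε : ℝ} (hε : 0 < ε) : ∃ b n L, ZZ q q' b n L ∧ L < ε := by
  have hM := M.monotoneLog hg hinj hv
  have hH : harmDefect (fun s t => M.logD v (g s) (g t)) x y z u = 0 := by
    have := p.logD_eq hpv
    rw [hp.1, hp.2.1, hp.2.2.1, hp.2.2.2] at this
    simp only [harmDefect]
    rw [M.logD_symm v (g z) (g y)]
    linarith
  obtain ⟨x₂, x₃, y₂, y₃, z₁, z₂, u₁, u₂, hAx₃, hx₃x, hxx₂, hx₂z, hzz₂, hz₂z₁, hz₁y₂, hy₂y, hyy₃,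
    hy₃u₁, hu₁B, hy₃u, hy₃u₂, hu₂B, e₁, e₂, e₃, e₄, e₅, l₁, l₂, l₃, l₄, l₅, l₆⟩ :=
    hM.exists_hexagon (ε := ε / 7) hx hxz hzy hyu hu hH (by positivity)
  obtain ⟨p₁, c₁, v₁⟩ := exists_hasCoords hinj hv hx (by linarith) (by linarith) (by linarith)
    hu₁B e₁
  obtain ⟨p₂, c₂, v₂⟩ := exists_hasCoords hinj hv (by linarith) (by linarith) (by linarith)
    (by linarith) hu₁B e₂
  obtain ⟨p₃, c₃, v₃⟩ := exists_hasCoords hinj hv (by linarith) (by linarith) (by linarith)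
    (by linarith) hu₂B e₃
  obtain ⟨p₄, c₄, v₄⟩ := exists_hasCoords hinj hv hAx₃ (by linarith) (by linarith)
    (by linarith) hu₂B e₄
  obtain ⟨p₅, c₅, v₅⟩ := exists_hasCoords hinj hv hAx₃ (by linarith) (by linarith)
    (by linarith) hu e₅
  have L : ∀ {q q' : HarmPt M} {x y z u z' u' : ℝ}, q.HasCoords g x y z u →
      q'.HasCoords g x y z' u' → leftAxisEq q q' := fun h h' =>
    Or.inl ⟨h.1.trans h'.1.symm, h.2.1.trans h'.2.1.symm⟩
  have R : ∀ {q q' : HarmPt M} {x y z u x' y' : ℝ}, q.HasCoords g x y z u →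
      q'.HasCoords g x' y' z u → rightAxisEq q q' := fun h h' =>
    Or.inl ⟨h.2.2.1.trans h'.2.2.1.symm, h.2.2.2.trans h'.2.2.2.symm⟩
  have r₁ : leftAxisEq p₁ p₁ ∧ rightAxisEq p₁ p₁ := ⟨L c₁ c₁, R c₁ c₁⟩
  have r₅ : leftAxisEq p₅ p₅ ∧ rightAxisEq p₅ p₅ := ⟨L c₅ c₅, R c₅ c₅⟩
  have d₁ : stepDistL q p₁ < ε / 7 := by
    refine (stepDistL_le_of_axisEq hpv v₁ (hpv.of_axisEq hl hr) v₁ hl hr r₁.1 r₁.2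
      (L hp c₁)).trans_lt ?_
    rwa [hp.stepDistL_eq c₁ hpv v₁,
      abs_of_pos (hM.innerLength_pos hx hxz (by linarith) (by linarith) (by linarith))]
  have d₂ : stepDistR p₁ p₂ < ε / 7 := by
    rwa [c₁.stepDistR_eq c₂ v₁ v₂,
      abs_of_pos (hM.outerLength_pos hx hxx₂ (by linarith) (by linarith) hu₁B)]
  have d₃ : stepDistL p₂ p₃ < ε / 7 := by
    rwa [c₂.stepDistL_eq c₃ v₂ v₃, innerLength_swap, abs_neg,
      abs_of_pos (hM.innerLength_pos (by linarith) (by linarith) hz₂z₁ (by linarith)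
        (by linarith))]
  have d₄ : stepDistR p₃ p₄ < 2 * (ε / 7) := by
    rwa [c₃.stepDistR_eq c₄ v₃ v₄, outerLength_swap, abs_neg,
      abs_of_pos (hM.outerLength_pos hAx₃ (by linarith) (by linarith) (by linarith) hu₂B)]
  have d₅ : stepDistL p₄ p₅ < ε / 7 := by
    rwa [c₄.stepDistL_eq c₅ v₄ v₅, innerLength_swap, abs_neg,
      abs_of_pos (hM.innerLength_pos hAx₃ (by linarith) hzz₂ (by linarith) (by linarith))]
  have d₆ : stepDistR p₅ q' < ε / 7 := by
    refine (stepDistR_le_of_axisEq v₅ hpv v₅ (hpv.of_axisEq hl' hr') r₅.1 r₅.2 hl' hr'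
      (R c₅ hp)).trans_lt ?_
    rwa [c₅.stepDistR_eq hp v₅ hpv,
      abs_of_pos (hM.outerLength_pos hAx₃ hx₃x hxz (by linarith) hu)]
  have I : ∀ {t : ℝ}, x₃ ≤ t → (t ≤ u ∨ t ≤ u₁ ∨ t ≤ u₂) → t ∈ Ioo A B := fun h h' =>
    ⟨by linarith, by rcases h' with h' | h' | h' <;> linarith⟩
  have n₁ : ¬ rightAxisEq q p₁ := fun h =>
    hp.not_rightAxisEq hinj c₁ (I (by linarith) (Or.inl (by linarith)))
      (I (by linarith) (Or.inl (by linarith))) (I (by linarith) (Or.inr (Or.inl le_rfl)))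
      (by linarith : z < z₁).ne (by linarith : z < u₁).ne (hr.symm.trans h)
  have n₂ : ¬ leftAxisEq p₁ p₂ :=
    c₁.not_leftAxisEq hinj c₂ (I (by linarith) (Or.inl (by linarith)))
      (I (by linarith) (Or.inl (by linarith))) (I (by linarith) (Or.inl (by linarith)))
      hxx₂.ne (by linarith : x < y₂).ne
  have n₃ : ¬ rightAxisEq p₂ p₃ :=
    c₂.not_rightAxisEq hinj c₃ (I (by linarith) (Or.inl (by linarith)))
      (I (by linarith) (Or.inl (by linarith))) (I (by linarith) (Or.inr (Or.inr le_rfl)))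
      hz₂z₁.ne' (by linarith : z₁ < u₂).ne
  have n₄ : ¬ leftAxisEq p₃ p₄ :=
    c₃.not_leftAxisEq hinj c₄ (I (by linarith) (Or.inl (by linarith)))
      (I (by linarith) (Or.inl (by linarith))) (I (by linarith) (Or.inl (by linarith)))
      (by linarith : x₃ < x₂).ne' (by linarith : x₂ < y₃).ne
  have n₅ : ¬ rightAxisEq p₄ p₅ :=
    c₄.not_rightAxisEq hinj c₅ (I (by linarith) (Or.inl (by linarith)))
      (I (by linarith) (Or.inl (by linarith))) (I (by linarith) (Or.inl le_rfl))
      hzz₂.ne' (by linarith : z₂ < u).ne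
  have n₆ : ¬ leftAxisEq p₅ q' := fun h =>
    c₅.not_leftAxisEq hinj hp (I (by linarith) (Or.inl (by linarith)))
      (I (by linarith) (Or.inl (by linarith))) (I (by linarith) (Or.inl (by linarith)))
      hx₃x.ne (by linarith : x₃ < y).ne (h.trans hl')
  refine ⟨_, _, _, .left n₁ (hl.trans (L hp c₁)) <| .right n₂ (R c₁ c₂) <| .left n₃ (L c₂ c₃) <|
    .right n₄ (R c₃ c₄) <| .left n₅ (L c₄ c₅) <| .right n₆ ((R c₅ hp).trans hr'.symm) <|
    .nil q' true, ?_⟩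
  linarith

/-- Two representatives of the same point of `Harm` are joined by arbitrarily short
nondegenerate zig-zag paths. -/
theorem exists_small_loop {q q' : HarmPt M} (hl : leftAxisEq q q') (hr : rightAxisEq q q')
    {ε : ℝ} (hε : 0 < ε) : ∃ b n L, ZZ q q' b n L ∧ L < ε := by
  obtain ⟨v, hv⟩ := M.exists_forall_ne {q.x, q.y, q.z, q.u}
  simp only [Finset.mem_insert, Finset.mem_singleton, forall_eq_or_imp, forall_eq] at hv
  obtain ⟨v1, v2, v3, v4⟩ := hv
  have hqv : q.Avoids v := ⟨v1.symm, v2.symm, v3.symm, v4.symm⟩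
  obtain ⟨A, B, g, hg, hinj, hgv, hsurj⟩ := M.exists_coordinate v
  have hM := M.monotoneLog hg hinj hgv
  obtain ⟨x, hx, ex⟩ := hsurj q.x hqv.1
  obtain ⟨y, hy, ey⟩ := hsurj q.y hqv.2.1
  obtain ⟨z, hz, ez⟩ := hsurj q.z hqv.2.2.1
  obtain ⟨u, hu, eu⟩ := hsurj q.u hqv.2.2.2
  have key : ∀ {p q q' : HarmPt M} {x y z u : ℝ}, p.HasCoords g x y z u → p.Avoids v →
      x ∈ Ioo A B → y ∈ Ioo A B → z ∈ Ioo A B → u ∈ Ioo A B → x < y → z < u → x < z →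
      leftAxisEq q p → rightAxisEq q p → leftAxisEq q' p → rightAxisEq q' p →
      ∃ b n L, ZZ q q' b n L ∧ L < ε := by
    intro p q q' x y z u hp hpv hx hy hz hu hxy hzu hxz hl hr hl' hr'
    have hH := p.logD_eq hpv
    rw [hp.1, hp.2.1, hp.2.2.1, hp.2.2.2] at hH
    have hzy : z < y := by
      by_contra! h
      have h := h.lt_of_ne fun h => p.hyz (by rw [hp.2.1, hp.2.2.1, h])
      have := hM.lt_outer hx.1 hxy h hzu hu.2
      linarith
    have hyu : y < u := by
      by_contra! h
      have h := h.lt_of_ne fun h => p.hyu (by rw [hp.2.1, hp.2.2.2, h])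
      have := hM.lt_side hx.1 hxz hzu h hy.2
      rw [M.logD_symm v (g u), M.logD_symm v (g z)] at this
      linarith
    exact hp.exists_small_loop hg hinj hgv hpv hx.1 hxz hzy hyu hu.2 hl hr hl' hr' hε
  have key' : ∀ {p : HarmPt M} {x y z u : ℝ}, p.HasCoords g x y z u → p.Avoids v →
      x ∈ Ioo A B → y ∈ Ioo A B → z ∈ Ioo A B → u ∈ Ioo A B → x < y → z < u →
      leftAxisEq q p → rightAxisEq q p → leftAxisEq q' p → rightAxisEq q' p →
      ∃ b n L, ZZ q q' b n L ∧ L < ε := by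
    intro p x y z u hp hpv hx hy hz hu hxy hzu hl hr hl' hr'
    rcases lt_trichotomy x z with h | h | h
    · exact key hp hpv hx hy hz hu hxy hzu h hl hr hl' hr'
    · exact absurd (by rw [hp.1, hp.2.2.1, h]) p.hxz
    · obtain ⟨b, n, L, h1, h2⟩ := key (p := p.swap) (q := q.swap) (q' := q'.swap)
        ⟨hp.2.2.1, hp.2.2.2, hp.1, hp.2.1⟩ hpv.swap hz hu hx hy hzu hxy h hr hl hr' hl'
      exact ⟨_, n, L, h1.swap, h2⟩
  have hl₀ : leftAxisEq q q := Or.inl ⟨rfl, rfl⟩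
  have hr₀ : rightAxisEq q q := Or.inl ⟨rfl, rfl⟩
  have hxy : x ≠ y := fun h => q.hxy (by rw [← ex, ← ey, h])
  have hzu : z ≠ u := fun h => q.hzu (by rw [← ez, ← eu, h])
  rcases hxy.lt_or_gt with h1 | h1 <;> rcases hzu.lt_or_gt with h2 | h2
  · exact key' ⟨ex.symm, ey.symm, ez.symm, eu.symm⟩ hqv hx hy hz hu h1 h2 hl₀ hr₀ hl.symm hr.symm
  · exact key' (p := q.swapRight) ⟨ex.symm, ey.symm, eu.symm, ez.symm⟩ hqv.swapRight hx hy hu hz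
      h1 h2 hl₀ (Or.symm hr₀) hl.symm (Or.symm hr.symm)
  · exact key' (p := q.swapLeft) ⟨ey.symm, ex.symm, ez.symm, eu.symm⟩ hqv.swapLeft hy hx hz hu
      h1 h2 (Or.symm hl₀) hr₀ (Or.symm hl.symm) hr.symm
  · exact key' (p := q.swapLeft.swapRight) ⟨ey.symm, ex.symm, eu.symm, ez.symm⟩
      hqv.swapLeft.swapRight hy hx hu hz h1 h2 (Or.symm hl₀) (Or.symm hr₀) (Or.symm hl.symm)
      (Or.symm hr.symm)

theorem zzDist_eq_stepDistL {q q' : HarmPt M} (h : leftAxisEq q q') :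
    zzDist q q' = ENNReal.ofReal (stepDistL q q') := by
  refine le_antisymm ?_ (le_sInf ?_)
  · by_cases hr : rightAxisEq q q'
    · rw [stepDistL_eq_zero h hr]
      refine ENNReal.le_of_forall_pos_le_add fun ε hε _ => ?_
      obtain ⟨b, n, L, hz, hL⟩ := exists_small_loop h hr (ε := ε) (by exact_mod_cast hε)
      rw [ENNReal.ofReal_zero, zero_add, ← ENNReal.ofReal_coe_nnreal]
      exact le_trans (sInf_le ⟨L, b, n, hz, rfl⟩) (ENNReal.ofReal_le_ofReal hL.le)
    · exact sInf_le ⟨_, true, 1, .left hr h (.nil q' false), by rw [add_zero]⟩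
  · rintro _ ⟨r, b, n, hz, rfl⟩
    exact ENNReal.ofReal_le_ofReal (hz.stepDistL_le h)

end SmallLoops

/-- **Main Theorem.** Let `M` be a monotone Möbius structure on the circle
satisfying the Increment axiom. Then every line `h ⊂ Harm` is a geodesic for the zig-zag
pseudometric `δ`: for any `q, q'` on a common (left or right) line,
`δ(q,q') = |qq'|`. -/
theorem stmt19 {X : Type*} [CircularOrder X] [TopologicalSpace X]
    {M : MonotoneMobius X} (hI : M.Increment) :
    (∀ q q' : HarmPt M, leftAxisEq q q' →
      zzDist q q' = ENNReal.ofReal (stepDistL q q')) ∧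
    (∀ q q' : HarmPt M, rightAxisEq q q' →
      zzDist q q' = ENNReal.ofReal (stepDistR q q')) :=
  ⟨fun _ _ h => zzDist_eq_stepDistL h, fun q q' h => by
    rw [← zzDist_swap]
    exact zzDist_eq_stepDistL (leftAxisEq_swap h)⟩
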